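/- Gross–Witten sum rule (strongly coupled phase): Let −1 ≤ g ≤ 0 and let GW(g) be the measure (1/2π)(1 + g·cos θ)dθ on the unit circle 𝕋. For every nontrivial probability measure ν on 𝕋 with Verblunsky coefficients (α_k)_{k≥0} and α_{−1} = −1: K(GW(g) | ν) = H(g) + g/2 − (g/2)·∑_{k=0}^∞ |α_k − α_{k−1}|² + ∑_{k=0}^∞ [−log(1−|α_k|²) + g·|α_k|²], where H(g) = K(GW(g) | UNIF) = 1 − √(1−g²) + log((1+√(1−g²))/2), and where both sides may be infinite simultaneously. -/

import Mathlib

open MeasureTheory Real Filter Set Topology Polynomial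
open scoped ENNReal ComplexConjugate

noncomputable section

namespace SumRules

-- Kullback–Leibler divergence `K(ν | μ)`.
open Classical in
def KLdiv {α : Type*} [MeasurableSpace α] (ν μ : Measure α) : ℝ≥0∞ :=
  if ν ≪ μ ∧ Integrable (llr ν μ) ν then ENNReal.ofReal (∫ x, llr ν μ x ∂ν) else ⊤

/-- The (topological) support of a measure. -/
def suppSet {α : Type*} [TopologicalSpace α] [MeasurableSpace α] (μ : Measure α) : Set α :=
  {x | ∀ U ∈ nhds x, μ U ≠ 0}

/-- A measure is nontrivial if its support is infinite, i.e. it is not carried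
by any finite set. -/
def InfiniteSupport {α : Type*} [MeasurableSpace α] (μ : Measure α) : Prop :=
  ∀ s : Finset α, μ (↑s : Set α)ᶜ ≠ 0

/-- The set of support points outside `[cm, cp]`. -/
def ES (μ : Measure ℝ) (cm cp : ℝ) : Set ℝ := suppSet μ \ Icc cm cp

/-- `μ ∈ 𝒮₁(cm, cp)`: the support of `μ` is contained in `[cm, cp]` together with an
at most countable set of points outside this interval. -/
def InS1 (μ : Measure ℝ) (cm cp : ℝ) : Prop := (ES μ cm cp).Countable

/-- `a b` (indexed so that `a (k+1) = a_{k+1}`, `b (k+1) = b_{k+1}`, `k ≥ 0`) are the Jacobi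
coefficients of `μ`: there is a sequence of orthonormal polynomials (with positive leading
coefficients, obtained by Gram-Schmidt from `1, x, x², …`) satisfying the three-term recursion. -/
def IsJacobi (μ : Measure ℝ) (a b : ℕ → ℝ) : Prop :=
  (∀ k : ℕ, 0 < a (k+1)) ∧
  ∃ p : ℕ → Polynomial ℝ,
    (∀ k, (p k).natDegree = k) ∧ (∀ k, 0 < (p k).leadingCoeff) ∧
    (∀ j k, ∫ x, (p j).eval x * (p k).eval x ∂μ = if j = k then 1 else 0) ∧
    (∀ (k : ℕ) (x : ℝ), x * (p k).eval x =
      a (k+1) * (p (k+1)).eval x + b (k+1) * (p k).eval x +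
        (if k = 0 then 0 else a k * (p (k-1)).eval x))

/-- `u` is the sequence of canonical moments of a measure on `[-2,2]` (with `u 0 = -1`). -/
def IsCanonicalMoments (μ : Measure ℝ) (u : ℕ → ℝ) : Prop :=
  u 0 = -1 ∧ (∀ k : ℕ, u (k+1) ∈ Ioo (-1 : ℝ) 1) ∧
  ∃ a b : ℕ → ℝ, IsJacobi μ a b ∧
    (∀ k : ℕ, b (k+1) = (1 - u (2*k)) * u (2*k+1) - (1 + u (2*k)) * u (2*k-1)) ∧
    (∀ k : ℕ, (a (k+1))^2 = (1 - u (2*k)) * (1 - (u (2*k+1))^2) * (1 + u (2*k+2)))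

/-- `z` is the sequence of canonical coefficients of a measure supported in `[0,∞)`. -/
def IsCanonicalZ (μ : Measure ℝ) (z : ℕ → ℝ) : Prop :=
  z 0 = 0 ∧ (∀ k : ℕ, 0 ≤ z (k+1)) ∧
  ∃ a b : ℕ → ℝ, IsJacobi μ a b ∧
    (∀ k : ℕ, b (k+1) = z (2*k) + z (2*k+1)) ∧
    (∀ k : ℕ, (a (k+1))^2 = z (2*k+1) * z (2*k+2))

def Gfun (x : ℝ) : ℝ := x - 1 - Real.log x

/-- The semicircle law. -/
def SCm : Measure ℝ :=
  volume.withDensity fun x => ENNReal.ofReal (Real.sqrt (4 - x^2) / (2*π))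

/-- The arcsine law on `(-2,2)`. -/
def ArcsineM : Measure ℝ :=
  volume.withDensity fun x => ENNReal.ofReal (1 / (π * Real.sqrt (4 - x^2)))

/-- The measure with density `(2/(π|q-p|)) √((x-p)/(q-x))` between `p` and `q`. -/
def Dmeas (p q : ℝ) : Measure ℝ :=
  volume.withDensity fun x => ENNReal.ofReal (2/(π * |q - p|) * Real.sqrt ((x - p)/(q - x)))

/-- The point `e^{iθ}` on the unit circle. -/
def ctheta (θ : ℝ) : ℂ := Complex.exp (θ * Complex.I)

/-- Reversed polynomial `Φ*` with conjugated coefficients: `Φ*(z) = z^k conj(Φ(1/conj z))`. -/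
def polyStar (P : Polynomial ℂ) : Polynomial ℂ := (P.map (starRingEnd ℂ)).reverse

/-- `α` is the sequence of Verblunsky coefficients of the measure `ν` on the unit circle
(`ν` being given in angle coordinates, carried by `[0, 2π)`): the monic orthogonal
polynomials of `ν` satisfy the Szegő recursion with coefficients `α`. -/
def IsVerblunsky (ν : Measure ℝ) (α : ℕ → ℂ) : Prop :=
  (∀ k, ‖α k‖ < 1) ∧
  ∃ Φ : ℕ → Polynomial ℂ,
    (∀ k, (Φ k).Monic) ∧ (∀ k, (Φ k).natDegree = k) ∧
    (∀ j k, j ≠ k →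
      ∫ θ, conj ((Φ j).eval (ctheta θ)) * (Φ k).eval (ctheta θ) ∂ν = 0) ∧
    (∀ k, Φ (k+1) = Polynomial.X * Φ k - Polynomial.C (conj (α k)) * polyStar (Φ k))

/-- `γ` is the sequence of deformed Verblunsky coefficients of `ν`. -/
def IsDeformedVerblunsky (ν : Measure ℝ) (γ : ℕ → ℂ) : Prop :=
  ∃ α : ℕ → ℂ, IsVerblunsky ν α ∧
    ∀ k : ℕ, γ k = conj (α k) * ∏ j ∈ Finset.range k, (1 - conj (γ j)) / (1 - γ j)

/-- Symmetry of a measure on the circle (in angle coordinates): invariance under conjugation. -/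
def SymmCircle (ν : Measure ℝ) : Prop :=
  (ν.map ctheta).map (starRingEnd ℂ) = ν.map ctheta

/-- The uniform measure on the circle, in angle coordinates. -/
def UNIFm : Measure ℝ :=
  volume.withDensity fun θ => ENNReal.ofReal (if 0 ≤ θ ∧ θ < 2*π then 1/(2*π) else 0)

end SumRules

namespace SumRules

/-- Outlier contribution for the Killip–Simon sum rule (`+∞` inside `(-2,2)`). -/
def FSC (x : ℝ) : ℝ≥0∞ :=
  if 2 ≤ |x| then
    ENNReal.ofReal (|x|/2 * Real.sqrt (x^2 - 4) - 2 * Real.log ((|x| + Real.sqrt (x^2 - 4))/2))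
  else ⊤

/-- Coefficient side of the Killip–Simon sum rule. -/
def IH (a b : ℕ → ℝ) : ℝ≥0∞ :=
  (1/2 : ℝ≥0∞) * ∑' k : ℕ, ENNReal.ofReal ((b (k+1))^2)
    + ∑' k : ℕ, ENNReal.ofReal (Gfun ((a (k+1))^2))

def tauM (τ : ℝ) : ℝ := (1 - Real.sqrt τ)^2
def tauP (τ : ℝ) : ℝ := (1 + Real.sqrt τ)^2

/-- The Marchenko–Pastur law with parameter `τ`. -/
def MPm (τ : ℝ) : Measure ℝ :=
  volume.withDensity fun x =>
    ENNReal.ofReal (Real.sqrt ((x - tauM τ) * (tauP τ - x)) / (2*π*τ*x))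

/-- Outlier contribution for the Marchenko–Pastur sum rule. -/
def FMP (τ : ℝ) (x : ℝ) : ℝ≥0∞ :=
  if tauP τ ≤ x then
    ENNReal.ofReal (∫ t in (tauP τ)..x, Real.sqrt ((t - tauP τ) * (t - tauM τ)) / (τ*t))
  else if 0 < x ∧ x ≤ tauM τ then
    ENNReal.ofReal (∫ t in x..(tauM τ), Real.sqrt ((t - tauP τ) * (t - tauM τ)) / (τ*t))
  else ⊤

/-- Coefficient side of the Marchenko–Pastur sum rule. -/
def IL (τ : ℝ) (z : ℕ → ℝ) : ℝ≥0∞ :=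
  ∑' k : ℕ, ENNReal.ofReal (τ⁻¹ * Gfun (z (2*k+1)) + Gfun (τ⁻¹ * z (2*k+2)))

def uPl (κ₁ κ₂ : ℝ) : ℝ :=
  2*(κ₂^2 - κ₁^2 + 4*Real.sqrt ((1+κ₁)*(1+κ₂)*(1+κ₁+κ₂)))/(2+κ₁+κ₂)^2
def uMi (κ₁ κ₂ : ℝ) : ℝ :=
  2*(κ₂^2 - κ₁^2 - 4*Real.sqrt ((1+κ₁)*(1+κ₂)*(1+κ₁+κ₂)))/(2+κ₁+κ₂)^2

/-- The Kesten–McKay law with parameters `κ₁, κ₂`. -/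
def KMKm (κ₁ κ₂ : ℝ) : Measure ℝ :=
  volume.withDensity fun x =>
    ENNReal.ofReal ((2+κ₁+κ₂)/(2*π) * Real.sqrt ((x - uMi κ₁ κ₂) * (uPl κ₁ κ₂ - x)) / (4 - x^2))

def ue (κ₁ κ₂ : ℝ) : ℝ := -(κ₁+κ₂)/(2+κ₁+κ₂)
def uo (κ₁ κ₂ : ℝ) : ℝ := (κ₂-κ₁)/(2+κ₁+κ₂)

def He (κ₁ κ₂ u : ℝ) : ℝ :=
  -(1+κ₁+κ₂) * Real.log ((1-u)/(1 - ue κ₁ κ₂)) - Real.log ((1+u)/(1 + ue κ₁ κ₂))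
def Ho (κ₁ κ₂ u : ℝ) : ℝ :=
  -(1+κ₁) * Real.log ((1-u)/(1 - uo κ₁ κ₂)) - (1+κ₂) * Real.log ((1+u)/(1 + uo κ₁ κ₂))

/-- Coefficient side of the Kesten–McKay sum rule. -/
def IJ (κ₁ κ₂ : ℝ) (u : ℕ → ℝ) : ℝ≥0∞ :=
  ∑' k : ℕ, (ENNReal.ofReal (Ho κ₁ κ₂ (u (2*k+1))) + ENNReal.ofReal (He κ₁ κ₂ (u (2*k+2))))

/-- Outlier contribution for the Kesten–McKay sum rule. -/
def FKMK (κ₁ κ₂ : ℝ) (x : ℝ) : ℝ≥0∞ :=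
  if uPl κ₁ κ₂ ≤ x then
    ENNReal.ofReal (∫ t in (uPl κ₁ κ₂)..x,
      (2+κ₁+κ₂) * Real.sqrt ((t - uPl κ₁ κ₂) * (t - uMi κ₁ κ₂)) / (4 - t^2))
  else if x ≤ uMi κ₁ κ₂ then
    ENNReal.ofReal (∫ t in x..(uMi κ₁ κ₂),
      (2+κ₁+κ₂) * Real.sqrt ((t - uPl κ₁ κ₂) * (t - uMi κ₁ κ₂)) / (4 - t^2))
  else ⊤

def Hgw (g : ℝ) : ℝ := 1 - Real.sqrt (1 - g^2) + Real.log ((1 + Real.sqrt (1 - g^2))/2)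

def thetaG (g : ℝ) : ℝ := 2 * Real.arcsin (Real.sqrt (1/|g|))

/-- The Gross–Witten measures, in angle coordinates. -/
def GWm (g : ℝ) : Measure ℝ :=
  if |g| ≤ 1 then
    volume.withDensity fun θ =>
      ENNReal.ofReal (if 0 ≤ θ ∧ θ < 2*π then (1 + g * Real.cos θ)/(2*π) else 0)
  else if g < -1 then
    volume.withDensity fun θ => ENNReal.ofReal (
      if π - thetaG g ≤ θ ∧ θ ≤ π + thetaG g then
        |g| / π * Real.sin (θ/2) * Real.sqrt (Real.sin (θ/2)^2 - Real.cos (thetaG g/2)^2)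
      else 0)
  else
    volume.withDensity fun θ => ENNReal.ofReal (
      if -thetaG g ≤ θ ∧ θ ≤ thetaG g then
        g/π * Real.cos (θ/2) * Real.sqrt (Real.sin (thetaG g/2)^2 - Real.sin (θ/2)^2)
      else 0)

def thetaD (d : ℝ) : ℝ := 2 * Real.arcsin (d/(1+d))
def gammaD (d : ℝ) : ℝ := -d/(1+d)

/-- The Hua–Pickrell measure, in angle coordinates. -/
def HPm (d : ℝ) : Measure ℝ :=
  volume.withDensity fun θ => ENNReal.ofReal (
    if thetaD d < θ ∧ θ < 2*π - thetaD d then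
      (1+d) * Real.sqrt (Real.sin (θ/2)^2 - Real.sin (thetaD d/2)^2) / (2*π*Real.sin (θ/2))
    else 0)

/-- The entropy-like function appearing in the Hua–Pickrell sum rule. -/
def HHP (d : ℝ) (γ : ℂ) : ℝ :=
  -Real.log ((1 - ‖γ‖^2)/(1 - (gammaD d)^2)) - 2*d*Real.log (‖1 - γ‖/(1 - gammaD d))

/-- Outlier contribution for the Hua–Pickrell sum rule (in angle coordinates). -/
def FHP (d : ℝ) (θ : ℝ) : ℝ≥0∞ :=
  if θ ≤ thetaD d then
    ENNReal.ofReal (∫ φ in θ..(thetaD d),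
      (1+d) * Real.sqrt (Real.sin (thetaD d/2)^2 - Real.sin (φ/2)^2) / Real.sin (φ/2))
  else if 2*π - thetaD d ≤ θ then
    ENNReal.ofReal (∫ φ in (2*π - thetaD d)..θ,
      (1+d) * Real.sqrt (Real.sin (thetaD d/2)^2 - Real.sin (φ/2)^2) / Real.sin (φ/2))
  else ⊤

/-- Set of outlying support points for a measure on the circle, in angle coordinates. -/
def EST (ν : Measure ℝ) (tm tp : ℝ) : Set ℝ := suppSet ν \ Icc tm tp

/-- `ν ∈ 𝒮₁^𝕋(tm, tp)` (in angle coordinates). -/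
def InS1T (ν : Measure ℝ) (tm tp : ℝ) : Prop := (EST ν tm tp).Countable

/-- The measure `𝒟(2,-2)`, with density `(1/2π)√((2-x)/(2+x))` on `(-2,2)`
(a shift of the hard-edge Marchenko–Pastur law). -/
def Dhard : Measure ℝ :=
  volume.withDensity fun x => ENNReal.ofReal (Real.sqrt ((2 - x)/(2 + x)) / (2*π))

/-- The mixture `μ_g = |g| 𝒟(2,-2) + (1-|g|) Arcsine`. -/
def mugMix (g : ℝ) : Measure ℝ :=
  ENNReal.ofReal |g| • Dhard + ENNReal.ofReal (1 - |g|) • ArcsineM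

/-- The mixture `ρ_g = |g| SC + (1-|g|) Arcsine`. -/
def rhog (g : ℝ) : Measure ℝ :=
  ENNReal.ofReal |g| • SCm + ENNReal.ofReal (1 - |g|) • ArcsineM

def Cg (g : ℝ) : ℝ :=
  -|g| * (1 - Real.log 2) + 1 - Real.sqrt (1 - g^2) + Real.log ((1 + Real.sqrt (1 - g^2))/2)

/-- The measure with density `(1/2π)(2+x)^{3/2}(2-x)^{1/2}` on `[-2,2]`. -/
def muHat : Measure ℝ :=
  volume.withDensity fun x =>
    ENNReal.ofReal ((2 + x) * Real.sqrt (2 + x) * Real.sqrt (2 - x) / (2*π))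

/-- The Poisson kernel measure `Pois(ζ)`, in angle coordinates. -/
def PoisM (ζ : ℂ) : Measure ℝ :=
  volume.withDensity fun θ => ENNReal.ofReal (
    if 0 ≤ θ ∧ θ < 2*π then (1 - ‖ζ‖^2)/(2*π*‖ctheta θ - ζ‖^2) else 0)

/-- The Carathéodory function of a measure on the circle (angle coordinates). -/
def Cara (ν : Measure ℝ) (z : ℂ) : ℂ := ∫ θ, (ctheta θ + z)/(ctheta θ - z) ∂ν

/-- `f` is the Schur function of `ν`. -/
def IsSchurFn (ν : Measure ℝ) (f : ℂ → ℂ) : Prop :=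
  DifferentiableOn ℂ f (Metric.ball 0 1) ∧
  (∀ z ∈ Metric.ball (0:ℂ) 1, ‖f z‖ ≤ 1) ∧
  (∀ z ∈ Metric.ball (0:ℂ) 1, Cara ν z - 1 = z * f z * (Cara ν z + 1))

/-- Möbius transform of the unit disk. -/
def mtrans (ρ z : ℂ) : ℂ := (z - ρ)/(1 - conj ρ * z)

def npRaw (ρ : ℂ) (g : ℂ → ℂ) (z : ℂ) : ℂ :=
  ((-ρ/(‖ρ‖ : ℂ)) / mtrans ρ z) * ((g z - g ρ)/(1 - conj (g ρ) * g z))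

-- One step of the Nevanlinna–Pick algorithm at `ρ` (the removable singularity at `ρ`
-- is filled in by the limit).
open Classical in
def npStep (ρ : ℂ) (g : ℂ → ℂ) : ℂ → ℂ := fun z =>
  if z = ρ then limUnder (𝓝[≠] ρ) (npRaw ρ g) else npRaw ρ g z

def schurRaw (g : ℂ → ℂ) (z : ℂ) : ℂ := ((g z - g 0)/z)/(1 - conj (g 0) * g z)

-- One step of the classical Schur algorithm (the removable singularity at `0`
-- is filled in by the limit).
open Classical in
def schurStep (g : ℂ → ℂ) : ℂ → ℂ := fun z =>
  if z = 0 then limUnder (𝓝[≠] (0:ℂ)) (schurRaw g) else schurRaw g z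

def xdHP (d : ℝ) : ℝ := 2*(1 + 2*d - d^2)/(1+d)^2

def uKMK (d : ℝ) : ℝ := 2*Real.sqrt (1 + 2*d)/(1+d)

end SumRules

namespace SumRules

lemma KLdiv_eq {α : Type*} [MeasurableSpace α] (μ ν : Measure α) [IsProbabilityMeasure μ]
    [IsProbabilityMeasure ν] : KLdiv μ ν = InformationTheory.klDiv μ ν := by
  rw [InformationTheory.klDiv, KLdiv]
  simp

lemma integrable_of_bdd {α : Type*} [MeasurableSpace α] {μ : Measure α} [IsFiniteMeasure μ]
    {f : α → ℝ} (hf : Measurable f) {a b : ℝ} (h : ∀ x, f x ∈ Icc a b) : Integrable f μ :=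
  Integrable.of_mem_Icc a b hf.aemeasurable (Eventually.of_forall h)

lemma log_mem_Icc {a b x : ℝ} (ha : 0 < a) (h : x ∈ Icc a b) :
    Real.log x ∈ Icc (Real.log a) (Real.log b) :=
  ⟨Real.log_le_log ha h.1, Real.log_le_log (ha.trans_le h.1) h.2⟩

/-- easy half of the variational formula -/
lemma dv_easy {α : Type*} [MeasurableSpace α] (μ ν : Measure α) [IsProbabilityMeasure μ]
    [IsProbabilityMeasure ν] (hK : KLdiv μ ν ≠ ⊤) (T : α → ℝ) (hT : Measurable T)
    (a b : ℝ) (ha : 0 < a) (hab : ∀ x, T x ∈ Icc a b) :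
    ∫ x, Real.log (T x) ∂μ - ∫ x, T x ∂ν + 1 ≤ (KLdiv μ ν).toReal := by
  rw [KLdiv_eq] at *
  obtain ⟨hac, hint⟩ := InformationTheory.klDiv_ne_top_iff.1 hK
  rw [InformationTheory.toReal_klDiv_eq_integral_klFun hac]
  have h1 : Integrable (fun x => Real.log (T x)) μ :=
    integrable_of_bdd hT.log (fun x => log_mem_Icc ha (hab x))
  have h2 : Integrable T ν := integrable_of_bdd hT hab
  have h3 := (integrable_rnDeriv_smul_iff hac).2 h1
  rw [← integral_rnDeriv_smul hac (f := fun x => Real.log (T x)), ← integral_sub h3 h2]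
  have h32 : Integrable (fun x => (μ.rnDeriv ν x).toReal • Real.log (T x) - T x) ν := h3.sub h2
  have : (1:ℝ) = ∫ x, (1:ℝ) ∂ν := by simp
  rw [this, ← integral_add h32 (integrable_const _)]
  refine integral_mono (h32.add (integrable_const _))
    ((InformationTheory.integrable_klFun_rnDeriv_iff hac).2 hint) (fun x => ?_)
  simp only [InformationTheory.klFun_apply, smul_eq_mul, Pi.sub_apply, Pi.add_apply]
  set h := (μ.rnDeriv ν x).toReal with hh
  have hTx : 0 < T x := ha.trans_le (hab x).1
  rcases (ENNReal.toReal_nonneg : 0 ≤ (μ.rnDeriv ν x).toReal).eq_or_lt with h0 | h0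
  · rw [← hh] at h0
    rw [← h0]; simp [hTx.le]
  · rw [← hh] at h0
    have := Real.log_le_sub_one_of_pos (div_pos hTx h0)
    rw [Real.log_div hTx.ne' h0.ne'] at this
    have h5 := mul_le_mul_of_nonneg_left this h0.le
    have : h * (T x / h - 1) = T x - h := by field_simp
    rw [this] at h5
    linarith

/-- hard half of the variational formula -/
lemma dv_hard {α : Type*} [MeasurableSpace α] (μ ν : Measure α) [IsProbabilityMeasure μ]
    [IsProbabilityMeasure ν] (M : ℝ)
    (H : ∀ (T : α → ℝ) (a b : ℝ), Measurable T → 0 < a → (∀ x, T x ∈ Icc a b) →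
      ∫ x, Real.log (T x) ∂μ - ∫ x, T x ∂ν + 1 ≤ M) :
    KLdiv μ ν ≤ ENNReal.ofReal M := by
  have hac : μ ≪ ν := by
    refine Measure.AbsolutelyContinuous.mk fun A hA hνA => ?_
    by_contra hne
    have hpos : 0 < μ.real A := by
      rw [measureReal_def]; exact ENNReal.toReal_pos hne (measure_ne_top _ _)
    set L : ℝ := (|M| + 1) / μ.real A with hL
    have hL0 : 0 < L := by positivity
    have key := H (fun x => Real.exp (A.indicator (fun _ => L) x)) 1 (Real.exp L)
      (Real.measurable_exp.comp (measurable_const.indicator hA)) one_pos (fun x => by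
        by_cases hx : x ∈ A
        · simp [hx, hL0.le]
        · simp [hx, hL0.le])
    simp only [Real.log_exp] at key
    rw [integral_indicator hA] at key
    have h2 : ∫ x, Real.exp (A.indicator (fun _ => L) x) ∂ν = 1 := by
      have : (fun x => Real.exp (A.indicator (fun _ => L) x)) =ᵐ[ν] fun _ => (1:ℝ) := by
        have : ∀ᵐ x ∂ν, x ∉ A := measure_eq_zero_iff_ae_notMem.1 hνA
        filter_upwards [this] with x hx
        simp [hx]
      rw [integral_congr_ae this]; simp
    rw [h2] at key
    simp only [integral_const, measureReal_restrict_apply_univ, smul_eq_mul] at key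
    rw [hL, mul_div_cancel₀ _ hpos.ne'] at key
    have := le_abs_self M
    linarith
  rw [KLdiv_eq, InformationTheory.klDiv_eq_lintegral_klFun_of_ac hac]
  set h : α → ℝ := fun x => (μ.rnDeriv ν x).toReal with hh
  have hm : Measurable h := (Measure.measurable_rnDeriv μ ν).ennreal_toReal
  have h0 : ∀ x, 0 ≤ h x := fun x => ENNReal.toReal_nonneg
  set T : ℕ → α → ℝ := fun n x => max (1 / ((n:ℝ)+1)) (min (h x) ((n:ℝ)+1)) with hTdef
  have hTm : ∀ n, Measurable (T n) := fun n => measurable_const.max (hm.min measurable_const)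
  have hTb : ∀ (n : ℕ) x, T n x ∈ Icc (1 / ((n:ℝ)+1)) ((n:ℝ)+1) := fun n x => by
    refine ⟨le_max_left _ _, max_le ?_ (min_le_right _ _)⟩
    have : (1:ℝ) ≤ n + 1 := by linarith [Nat.cast_nonneg (α := ℝ) n]
    exact (div_le_one (by positivity)).2 this |>.trans this
  have hapos : ∀ n : ℕ, 0 < 1 / ((n:ℝ)+1) := fun n => by positivity
  set F : ℕ → α → ℝ := fun n x => h x * Real.log (T n x) - T n x + 1 with hF
  have hF0 : ∀ n x, 0 ≤ F n x := by
    intro n x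
    have hT0 : 0 < T n x := (hapos n).trans_le (hTb n x).1
    have hk := InformationTheory.klFun_nonneg hT0.le
    rw [InformationTheory.klFun_apply] at hk
    have hn1 : (1:ℝ) ≤ n + 1 := by linarith [Nat.cast_nonneg (α := ℝ) n]
    have hn2 : 1 / ((n:ℝ)+1) ≤ 1 := (div_le_one (by positivity)).2 hn1
    have : T n x * Real.log (T n x) ≤ h x * Real.log (T n x) := by
      rcases le_total (h x) 1 with hx | hx
      · have e1 : min (h x) ((n:ℝ)+1) = h x := min_eq_left (hx.trans hn1)
        have e2 : h x ≤ T n x := by simp only [hTdef, e1]; exact le_max_right _ _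
        have e3 : T n x ≤ 1 := by simp only [hTdef, e1]; exact max_le hn2 hx
        exact mul_le_mul_of_nonpos_right e2 (Real.log_nonpos hT0.le e3)
      · have e1 : 1 ≤ min (h x) ((n:ℝ)+1) := le_min hx hn1
        have e4 : T n x = min (h x) ((n:ℝ)+1) := max_eq_right (hn2.trans e1)
        exact mul_le_mul_of_nonneg_right (e4 ▸ min_le_left _ _) (Real.log_nonneg (e4 ▸ e1))
    simp only [hF]; linarith
  have hFm : ∀ n, Measurable (F n) := fun n =>
    ((hm.mul (hTm n).log).sub (hTm n)).add measurable_const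
  have hlim : ∀ x, Tendsto (fun n => F n x) atTop (𝓝 (InformationTheory.klFun (h x))) := by
    intro x
    have hz : Tendsto (fun n : ℕ => 1 / ((n:ℝ)+1)) atTop (𝓝 0) :=
      tendsto_one_div_add_atTop_nhds_zero_nat
    have hT : Tendsto (fun n => T n x) atTop (𝓝 (h x)) := by
      have e : (fun n => T n x) =ᶠ[atTop] fun n : ℕ => max (1 / ((n:ℝ)+1)) (h x) := by
        obtain ⟨N, hN⟩ := exists_nat_ge (h x)
        filter_upwards [eventually_ge_atTop N] with n hn
        have : h x ≤ (n:ℝ) + 1 := by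
          have : (N:ℝ) ≤ n := by exact_mod_cast hn
          linarith
        simp only [hTdef, min_eq_left this]
      refine Tendsto.congr' e.symm ?_
      have := hz.max (tendsto_const_nhds (x := h x))
      rwa [max_eq_right (h0 x)] at this
    rcases (h0 x).eq_or_lt with hx | hx
    · simp only [hF, ← hx, zero_mul, InformationTheory.klFun_zero]
      rw [← hx] at hT
      simpa using (tendsto_const_nhds (x := (0:ℝ))).sub hT |>.add_const 1
    · have := ((hT.log hx.ne').const_mul (h x)).sub hT |>.add_const 1
      rw [InformationTheory.klFun_apply]
      convert this using 2
      ring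
  have hliminf : ∀ x, ENNReal.ofReal (InformationTheory.klFun (h x))
      = liminf (fun n => ENNReal.ofReal (F n x)) atTop := fun x =>
    ((ENNReal.continuous_ofReal.tendsto _).comp (hlim x)).liminf_eq.symm
  calc ∫⁻ x, ENNReal.ofReal (InformationTheory.klFun (h x)) ∂ν
      = ∫⁻ x, liminf (fun n => ENNReal.ofReal (F n x)) atTop ∂ν := by simp_rw [hliminf]
    _ ≤ liminf (fun n => ∫⁻ x, ENNReal.ofReal (F n x) ∂ν) atTop :=
        lintegral_liminf_le fun n => (hFm n).ennreal_ofReal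
    _ ≤ liminf (fun n : ℕ => ENNReal.ofReal M) atTop := by
        refine liminf_le_liminf (Eventually.of_forall fun n => ?_)
        have i1 : Integrable (fun x => Real.log (T n x)) μ :=
          integrable_of_bdd (hTm n).log (fun x => log_mem_Icc (hapos n) (hTb n x))
        have i2 : Integrable (T n) ν := integrable_of_bdd (hTm n) (hTb n)
        have i3 := (integrable_rnDeriv_smul_iff hac).2 i1
        have i4 : Integrable (F n) ν := (i3.sub i2).add (integrable_const _)
        rw [← ofReal_integral_eq_lintegral_ofReal i4 (Eventually.of_forall (hF0 n))]
        refine ENNReal.ofReal_le_ofReal (le_trans (le_of_eq ?_)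
          (H (T n) _ _ (hTm n) (hapos n) (hTb n)))
        rw [← integral_rnDeriv_smul hac (f := fun x => Real.log (T n x)), ← integral_sub i3 i2]
        have : (1:ℝ) = ∫ x, (1:ℝ) ∂ν := by simp
        have i32 : Integrable (fun x => (μ.rnDeriv ν x).toReal • Real.log (T n x) - T n x) ν :=
          i3.sub i2
        conv_rhs => rw [this, ← integral_add i32 (integrable_const _)]
        rfl
    _ = ENNReal.ofReal M := by simp

lemma log_sub_log_le {a x y : ℝ} (ha : 0 < a) (hx : a ≤ x) (hy : a ≤ y) :
    Real.log x - Real.log y ≤ |x - y| / a := by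
  have hx0 := ha.trans_le hx
  have hy0 := ha.trans_le hy
  rw [← Real.log_div hx0.ne' hy0.ne']
  have h1 := Real.log_le_sub_one_of_pos (div_pos hx0 hy0)
  have h2 : x / y - 1 = (x - y) / y := by field_simp
  rw [h2] at h1
  refine h1.trans ?_
  calc (x - y) / y ≤ |x - y| / y := by gcongr; exact le_abs_self _
    _ ≤ |x - y| / a := by gcongr

/-- From continuous test functions to measurable ones. -/
lemma dv_of_continuous {X : Type*} [TopologicalSpace X] [MeasurableSpace X] [BorelSpace X]
    [NormalSpace X] (μ ν : Measure X) [IsProbabilityMeasure μ]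
    [IsProbabilityMeasure ν] [(μ + ν).WeaklyRegular] (M : ℝ)
    (H : ∀ (T : X → ℝ) (a b : ℝ), Continuous T → 0 < a → (∀ x, T x ∈ Icc a b) →
      ∫ x, Real.log (T x) ∂μ - ∫ x, T x ∂ν + 1 ≤ M)
    (T : X → ℝ) (a b : ℝ) (hT : Measurable T) (ha : 0 < a) (hab : ∀ x, T x ∈ Icc a b) :
      ∫ x, Real.log (T x) ∂μ - ∫ x, T x ∂ν + 1 ≤ M := by
  rcases isEmpty_or_nonempty X with hX | ⟨⟨x0⟩⟩
  · exact H T a b (by fun_prop) ha hab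
  have hab' : a ≤ b := (hab x0).1.trans (hab x0).2
  have hi : Integrable T (μ + ν) := integrable_of_bdd hT hab
  refine le_of_forall_pos_le_add fun ε hε => ?_
  obtain ⟨S, hS, hSi⟩ := hi.exists_boundedContinuous_integral_sub_le
    (show 0 < ε / (1/a + 1) by positivity)
  set S' : X → ℝ := fun x => max a (min (S x) b) with hS'
  have hS'c : Continuous S' := continuous_const.max (S.continuous.min continuous_const)
  have hS'b : ∀ x, S' x ∈ Icc a b := fun x => ⟨le_max_left _ _, max_le hab' (min_le_right _ _)⟩
  have key := H S' a b hS'c ha hS'b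
  have hd : ∀ x, |T x - S' x| ≤ ‖T x - S x‖ := by
    intro x
    obtain ⟨h1, h2⟩ := hab x
    have e : T x = max a (min (T x) b) := by rw [min_eq_left h2, max_eq_right h1]
    conv_lhs => rw [e]
    rw [Real.norm_eq_abs]
    have e1 := abs_max_sub_max_le_abs (min (T x) b) (min (S x) b) a
    have e2 := abs_inf_sub_inf_le_abs (T x) (S x) b
    simp only [hS', max_comm a]
    exact e1.trans e2
  have hD : Integrable (fun x => |T x - S' x|) (μ + ν) :=
    (hi.sub (integrable_of_bdd hS'c.measurable hS'b)).abs
  have hDle : ∫ x, |T x - S' x| ∂(μ+ν) ≤ ε / (1/a + 1) :=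
    (integral_mono hD (hi.sub hSi).norm hd).trans hS
  have hDμ := hD.left_of_add_measure
  have hDν := hD.right_of_add_measure
  rw [integral_add_measure hDμ hDν] at hDle
  have n1 : 0 ≤ ∫ x, |T x - S' x| ∂μ := integral_nonneg fun _ => abs_nonneg _
  have n2 : 0 ≤ ∫ x, |T x - S' x| ∂ν := integral_nonneg fun _ => abs_nonneg _
  have l1 : ∫ x, Real.log (T x) ∂μ - ∫ x, Real.log (S' x) ∂μ ≤ (∫ x, |T x - S' x| ∂μ) / a := by
    rw [← integral_sub (integrable_of_bdd hT.log fun x => log_mem_Icc ha (hab x))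
      (integrable_of_bdd hS'c.measurable.log fun x => log_mem_Icc ha (hS'b x)), ← integral_div]
    exact integral_mono ((integrable_of_bdd hT.log fun x => log_mem_Icc ha (hab x)).sub
      (integrable_of_bdd hS'c.measurable.log fun x => log_mem_Icc ha (hS'b x)))
      (hDμ.div_const _) (fun x => log_sub_log_le ha (hab x).1 (hS'b x).1)
  have l2 : ∫ x, S' x ∂ν - ∫ x, T x ∂ν ≤ ∫ x, |T x - S' x| ∂ν := by
    rw [← integral_sub (integrable_of_bdd hS'c.measurable hS'b) (integrable_of_bdd hT hab)]
    refine integral_mono ((integrable_of_bdd hS'c.measurable hS'b).sub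
      (integrable_of_bdd hT hab)) hDν (fun x => ?_)
    simp only
    rw [abs_sub_comm]; exact le_abs_self _
  have l3 : (∫ x, |T x - S' x| ∂μ) / a + ∫ x, |T x - S' x| ∂ν ≤ ε := by
    rw [le_div_iff₀ (by positivity)] at hDle
    refine le_trans ?_ hDle
    have : 0 ≤ (∫ x, |T x - S' x| ∂ν) * (1 / a) := by positivity
    have e : (∫ x, |T x - S' x| ∂μ) / a = (∫ x, |T x - S' x| ∂μ) * (1/a) := by ring
    rw [e]
    nlinarith
  linarith

instance fact_two_pi : Fact (0 < 2 * π) := ⟨Real.two_pi_pos⟩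

lemma measurable_coeC : Measurable (fun θ : ℝ => (θ : AddCircle (2 * π))) :=
  (AddCircle.continuous_mk' (2*π)).measurable

lemma kl_le_of_trig (μ ν : Measure ℝ) [IsProbabilityMeasure μ] [IsProbabilityMeasure ν]
    (hμ : μ (Ico 0 (2*π))ᶜ = 0) (hν : ν (Ico 0 (2*π))ᶜ = 0) (M : ℝ)
    (H : ∀ q ∈ Submodule.span ℂ (range (fun n : ℤ => (fourier n : C(AddCircle (2*π), ℂ)))),
      ∀ a b : ℝ, 0 < a → (∀ x, (q x).re ∈ Icc a b) →
      ∫ θ : ℝ, Real.log (q (θ : AddCircle (2*π))).re ∂μ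
        - ∫ θ : ℝ, (q (θ : AddCircle (2*π))).re ∂ν + 1 ≤ M) :
    KLdiv μ ν ≤ ENNReal.ofReal M := by
  have hmk := measurable_coeC
  set μ' := μ.map (fun θ : ℝ => (θ : AddCircle (2 * π))) with hμ'
  set ν' := ν.map (fun θ : ℝ => (θ : AddCircle (2 * π))) with hν'
  have : IsProbabilityMeasure μ' := Measure.isProbabilityMeasure_map hmk.aemeasurable
  have : IsProbabilityMeasure ν' := Measure.isProbabilityMeasure_map hmk.aemeasurable
  -- continuous test functions
  have Hc : ∀ (T : AddCircle (2*π) → ℝ) (a b : ℝ), Continuous T → 0 < a →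
      (∀ x, T x ∈ Icc a b) → ∫ x, Real.log (T x) ∂μ' - ∫ x, T x ∂ν' + 1 ≤ M := by
    intro T a b hT ha hab
    refine le_of_forall_pos_le_add fun ε hε => ?_
    let Tc : C(AddCircle (2*π), ℂ) := ⟨fun x => (T x : ℂ), by fun_prop⟩
    have hd : Tc ∈ (Submodule.span ℂ (range <| @fourier (2*π))).topologicalClosure := by
      rw [span_fourier_closure_eq_top]; trivial
    rw [← SetLike.mem_coe, Submodule.topologicalClosure_coe, Metric.mem_closure_iff] at hd
    obtain ⟨q, hq, hdist⟩ := hd (ε/2) (by positivity)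
    have hpt : ∀ x, |T x - (q x).re| ≤ ε/2 := by
      intro x
      have h1 : ‖Tc x - q x‖ ≤ ε/2 := by
        rw [← dist_eq_norm]; exact (ContinuousMap.dist_apply_le_dist x).trans hdist.le
      refine le_trans ?_ h1
      have := Complex.abs_re_le_norm (Tc x - q x)
      simpa [Tc] using this
    have h1mem : (fourier 0 : C(AddCircle (2*π), ℂ)) ∈
        Submodule.span ℂ (range <| @fourier (2*π)) := Submodule.subset_span ⟨0, rfl⟩
    set q' := q + ((ε/2 : ℝ) : ℂ) • (fourier 0 : C(AddCircle (2*π), ℂ)) with hq'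
    have hq'mem : q' ∈ Submodule.span ℂ (range <| @fourier (2*π)) :=
      Submodule.add_mem _ hq (Submodule.smul_mem _ _ h1mem)
    have hq're : ∀ x, (q' x).re = (q x).re + ε/2 := by
      intro x
      simp only [hq', ContinuousMap.add_apply, ContinuousMap.smul_apply, smul_eq_mul,
        fourier_zero, mul_one, Complex.add_re, Complex.ofReal_re]
    have hlow : ∀ x, T x ≤ (q' x).re := fun x => by
      rw [hq're]; linarith [(abs_le.1 (hpt x)).2]
    have hupp : ∀ x, (q' x).re ≤ T x + ε := fun x => by
      rw [hq're]; linarith [(abs_le.1 (hpt x)).1]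
    have hb' : ∀ x, (q' x).re ∈ Icc a (b + ε) := fun x =>
      ⟨(hab x).1.trans (hlow x), (hupp x).trans (by linarith [(hab x).2])⟩
    have key := H q' hq'mem a (b+ε) ha hb'
    have hq'm : Measurable (fun x => (q' x).re) :=
      (Complex.continuous_re.comp q'.continuous).measurable
    have e1 : ∫ θ : ℝ, Real.log (q' (θ : AddCircle (2*π))).re ∂μ
        = ∫ x, Real.log (q' x).re ∂μ' := by
      rw [hμ', integral_map hmk.aemeasurable]
      exact hq'm.log.aestronglyMeasurable
    have e2 : ∫ θ : ℝ, (q' (θ : AddCircle (2*π))).re ∂ν = ∫ x, (q' x).re ∂ν' := by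
      rw [hν', integral_map hmk.aemeasurable]
      exact hq'm.aestronglyMeasurable
    rw [e1, e2] at key
    have i1 : ∫ x, Real.log (T x) ∂μ' ≤ ∫ x, Real.log (q' x).re ∂μ' :=
      integral_mono (integrable_of_bdd hT.measurable.log fun x => log_mem_Icc ha (hab x))
        (integrable_of_bdd hq'm.log fun x => log_mem_Icc ha (hb' x))
        (fun x => Real.log_le_log (ha.trans_le (hab x).1) (hlow x))
    have i2 : ∫ x, (q' x).re ∂ν' ≤ ∫ x, T x ∂ν' + ε := by
      have : ∫ x, (T x + ε) ∂ν' = ∫ x, T x ∂ν' + ε := by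
        rw [integral_add (integrable_of_bdd hT.measurable hab) (integrable_const _)]; simp
      rw [← this]
      exact integral_mono (integrable_of_bdd hq'm hb')
        ((integrable_of_bdd hT.measurable hab).add (integrable_const _)) hupp
    linarith
  have Hm := dv_of_continuous μ' ν' M Hc
  refine dv_hard μ ν M fun T a b hT ha hab => ?_
  let e : AddCircle (2*π) → ℝ := fun x => (AddCircle.measurableEquivIco (2*π) 0 x : ℝ)
  have he : Measurable e := measurable_subtype_coe.comp (AddCircle.measurableEquivIco (2*π) 0).measurable
  have key := Hm (fun x => T (e x)) a b (hT.comp he) ha (fun x => hab _)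
  have hTe : Measurable (fun x => T (e x)) := hT.comp he
  have hee : ∀ θ ∈ Ico 0 (2*π), e (θ : AddCircle (2*π)) = θ := by
    intro θ hθ
    have : θ ∈ Ico 0 (0 + 2*π) := by simpa using hθ
    exact AddCircle.equivIco_coe_of_mem this
  have aeμ : ∀ᵐ θ ∂μ, θ ∈ Ico 0 (2*π) := by
    rw [ae_iff]; exact hμ
  have aeν : ∀ᵐ θ ∂ν, θ ∈ Ico 0 (2*π) := by
    rw [ae_iff]; exact hν
  rw [hμ', hν', integral_map hmk.aemeasurable hTe.log.aestronglyMeasurable,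
    integral_map hmk.aemeasurable hTe.aestronglyMeasurable] at key
  refine le_trans (le_of_eq ?_) key
  congr 2
  · exact integral_congr_ae (by filter_upwards [aeμ] with θ h; rw [hee θ h])
  · exact integral_congr_ae (by filter_upwards [aeν] with θ h; rw [hee θ h])

lemma ctheta_eq (θ : ℝ) : ctheta θ = circleMap 0 1 θ := by simp [ctheta, circleMap]

lemma norm_ctheta (θ : ℝ) : ‖ctheta θ‖ = 1 := by
  rw [ctheta]; exact Complex.norm_exp_ofReal_mul_I θ

lemma continuous_ctheta : Continuous ctheta := by unfold ctheta; fun_prop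

lemma ctheta_ne (θ : ℝ) : ctheta θ ≠ 0 := by
  rw [← norm_pos_iff, norm_ctheta]; exact one_pos

lemma conj_ctheta (θ : ℝ) : conj (ctheta θ) = (ctheta θ)⁻¹ := by
  rw [Complex.inv_def, Complex.normSq_eq_norm_sq, norm_ctheta]; simp

lemma re_ctheta (θ : ℝ) : (ctheta θ).re = Real.cos θ := by
  rw [ctheta, Complex.exp_ofReal_mul_I_re]

lemma ctheta_mem (θ : ℝ) : ctheta θ ∈ Metric.closedBall (0:ℂ) 1 := by
  simp [norm_ctheta]

lemma UNIFm_eq : UNIFm = ENNReal.ofReal (1/(2*π)) • volume.restrict (Ico 0 (2*π)) := by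
  rw [← withDensity_const, ← withDensity_indicator measurableSet_Ico, UNIFm]
  congr 1
  funext θ
  by_cases h : 0 ≤ θ ∧ θ < 2*π
  · simp [h, indicator, mem_Ico]
  · simp only [if_neg h, ENNReal.ofReal_zero, indicator, mem_Ico]

lemma integral_UNIFm {E : Type*} [NormedAddCommGroup E] [NormedSpace ℝ E] (f : ℝ → E) :
    ∫ θ, f θ ∂UNIFm = (2*π)⁻¹ • ∫ θ in (0:ℝ)..(2*π), f θ := by
  rw [UNIFm_eq, integral_smul_measure, intervalIntegral.integral_of_le Real.two_pi_pos.le,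
    integral_Ico_eq_integral_Ioc, ENNReal.toReal_ofReal (by positivity), one_div]

instance : IsProbabilityMeasure UNIFm := by
  constructor
  rw [UNIFm_eq]
  simp only [Measure.smul_apply, MeasurableSet.univ, Measure.restrict_apply, univ_inter,
    Real.volume_Ico, sub_zero, smul_eq_mul]
  rw [← ENNReal.ofReal_mul (by positivity), one_div, inv_mul_cancel₀ (by positivity)]
  simp

lemma integral_circ {h : ℂ → ℂ} : ∫ θ, h (ctheta θ) ∂UNIFm = Real.circleAverage h 0 1 := by
  rw [integral_UNIFm, Real.circleAverage]; simp_rw [ctheta_eq]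

lemma mean_value {h : ℂ → ℂ} (hh : DiffContOnCl ℂ h (Metric.ball 0 1)) :
    ∫ θ, h (ctheta θ) ∂UNIFm = h 0 := by
  rw [integral_circ]
  have : DiffContOnCl ℂ h (Metric.ball 0 |1|) := by simpa using hh
  exact this.circleAverage

lemma mean_value_deriv {h : ℂ → ℂ} (hh : DiffContOnCl ℂ h (Metric.ball 0 1)) :
    ∫ θ, (ctheta θ)⁻¹ * h (ctheta θ) ∂UNIFm = deriv h 0 := by
  have key := hh.deriv_eq_smul_circleIntegral one_pos
  have e : (∮ z in C(0, 1), (z - 0)⁻¹ • (z⁻¹ * h z)) = ∮ z in C(0, 1), (1 / (z - 0) ^ 2) • h z := by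
    refine circleIntegral.integral_congr zero_le_one fun z hz => ?_
    simp only [sub_zero, smul_eq_mul, one_div]
    rw [← mul_assoc, pow_two, mul_inv]
  rw [integral_circ (h := fun z => z⁻¹ * h z), Real.circleAverage_eq_circleIntegral one_ne_zero,
    e, key, smul_smul, inv_mul_cancel₀ Complex.two_pi_I_ne_zero, one_smul]

lemma integrable_circ {ρ : Measure ℝ} [IsFiniteMeasure ρ] {E : Type*} [NormedAddCommGroup E]
    {h : ℂ → E} (hh : ContinuousOn h (Metric.closedBall 0 1)) :
    Integrable (fun θ => h (ctheta θ)) ρ := by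
  have hc : Continuous fun θ => h (ctheta θ) :=
    hh.comp_continuous continuous_ctheta ctheta_mem
  obtain ⟨C, hC⟩ := (isCompact_closedBall (0:ℂ) 1).exists_bound_of_continuousOn hh
  exact Integrable.of_bound hc.aestronglyMeasurable C
    (Eventually.of_forall fun θ => hC _ (ctheta_mem θ))

/-- `∫ (1 + g cos θ) Re h = Re h(0) + (g/2) Re h'(0)` -/
lemma mean_weight (g : ℝ) {h : ℂ → ℂ} (hh : DiffContOnCl ℂ h (Metric.ball 0 1)) :
    ∫ θ, (1 + g * Real.cos θ) * (h (ctheta θ)).re ∂UNIFm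
      = (h 0).re + g / 2 * (deriv h 0).re := by
  have hcont : ContinuousOn h (Metric.closedBall 0 1) := by
    have := hh.continuousOn
    rwa [closure_ball _ one_ne_zero] at this
  have i1 : Integrable (fun θ => h (ctheta θ)) UNIFm := integrable_circ hcont
  have i2 : Integrable (fun θ => ctheta θ * h (ctheta θ)) UNIFm :=
    integrable_circ (h := fun z => z * h z) (continuousOn_id.mul hcont)
  have i3 : Integrable (fun θ => (ctheta θ)⁻¹ * h (ctheta θ)) UNIFm := by
    have := integrable_circ (ρ := UNIFm) (h := fun z => conj z * h z)
      (Complex.continuous_conj.continuousOn.mul hcont)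
    simpa only [conj_ctheta] using this
  have hz : DiffContOnCl ℂ (fun z => z * h z) (Metric.ball 0 1) := by
    have := (differentiable_id (𝕜 := ℂ) (E := ℂ)).diffContOnCl.smul hh (s := Metric.ball 0 1)
    simpa using this
  have m1 := mean_value hh
  have m2 := mean_value hz
  have m3 := mean_value_deriv hh
  simp only [zero_mul] at m2
  have e : ∀ θ, (1 + g * Real.cos θ) * (h (ctheta θ)).re
      = (h (ctheta θ) + (g/2 : ℝ) * (ctheta θ * h (ctheta θ)
        + (ctheta θ)⁻¹ * h (ctheta θ))).re := by
    intro θ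
    have : ctheta θ + (ctheta θ)⁻¹ = ((2 * Real.cos θ : ℝ) : ℂ) := by
      rw [← conj_ctheta, Complex.add_conj, re_ctheta]
    rw [← add_mul, this, ← mul_assoc, ← Complex.ofReal_mul, Complex.add_re, Complex.re_ofReal_mul]
    ring
  simp_rw [e]
  have i5 : Integrable (fun θ => ctheta θ * h (ctheta θ) + (ctheta θ)⁻¹ * h (ctheta θ)) UNIFm :=
    i2.add i3
  have i6 : Integrable (fun θ => ((g/2 : ℝ) : ℂ) * (ctheta θ * h (ctheta θ)
    + (ctheta θ)⁻¹ * h (ctheta θ))) UNIFm := i5.const_mul _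
  have i4 : Integrable (fun θ => h (ctheta θ) + (g/2 : ℝ) * (ctheta θ * h (ctheta θ)
        + (ctheta θ)⁻¹ * h (ctheta θ))) UNIFm := i1.add i6
  have := integral_re i4
  simp only [RCLike.re_to_complex] at this
  rw [this, integral_add i1 i6, integral_const_mul, integral_add i2 i3, m1, m2, m3, zero_add,
    Complex.add_re, Complex.re_ofReal_mul]

lemma one_add_nonneg {g : ℝ} (hg1 : -1 ≤ g) (hg0 : g ≤ 0) (θ : ℝ) : 0 ≤ 1 + g * Real.cos θ := by
  nlinarith [Real.cos_le_one θ, Real.neg_one_le_cos θ]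

lemma GWm_eq {g : ℝ} (hg1 : -1 ≤ g) (hg0 : g ≤ 0) :
    GWm g = UNIFm.withDensity fun θ => ENNReal.ofReal (1 + g * Real.cos θ) := by
  have habs : |g| ≤ 1 := abs_le.2 ⟨hg1, by linarith⟩
  rw [GWm, if_pos habs, UNIFm, ← withDensity_mul₀]
  · congr 1
    funext θ
    simp only [Pi.mul_apply]
    split_ifs with h
    · rw [← ENNReal.ofReal_mul (by positivity)]
      congr 1; ring
    · simp
  · refine (Measurable.ennreal_ofReal ?_).aemeasurable
    exact Measurable.ite measurableSet_Ico measurable_const measurable_const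
  · exact (Measurable.ennreal_ofReal (by fun_prop)).aemeasurable

lemma integral_GWm {g : ℝ} (hg1 : -1 ≤ g) (hg0 : g ≤ 0) (f : ℝ → ℝ) :
    ∫ θ, f θ ∂(GWm g) = ∫ θ, (1 + g * Real.cos θ) * f θ ∂UNIFm := by
  rw [GWm_eq hg1 hg0, integral_withDensity_eq_integral_toReal_smul
    (Measurable.ennreal_ofReal (by fun_prop)) (by simp)]
  simp_rw [ENNReal.toReal_ofReal (one_add_nonneg hg1 hg0 _), smul_eq_mul]

lemma isProb_GWm {g : ℝ} (hg1 : -1 ≤ g) (hg0 : g ≤ 0) : IsProbabilityMeasure (GWm g) := by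
  constructor
  rw [GWm_eq hg1 hg0, withDensity_apply _ MeasurableSet.univ, Measure.restrict_univ,
    ← ofReal_integral_eq_lintegral_ofReal]
  · have := mean_weight g (h := fun _ => 1) diffContOnCl_const
    simp only [Complex.one_re, mul_one, deriv_const, Complex.zero_re, mul_zero, add_zero] at this
    rw [this]; simp
  · have := integrable_circ (ρ := UNIFm) (h := fun z => 1 + g * z.re)
      (by fun_prop)
    simpa only [re_ctheta] using this
  · exact Eventually.of_forall (one_add_nonneg hg1 hg0)

lemma GWm_compl {g : ℝ} (hg1 : -1 ≤ g) (hg0 : g ≤ 0) : GWm g (Ico 0 (2*π))ᶜ = 0 := by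
  have h : GWm g ≪ UNIFm := by rw [GWm_eq hg1 hg0]; exact withDensity_absolutelyContinuous _ _
  apply h
  rw [UNIFm_eq]
  simp

lemma integrable_cont {ρ : Measure ℝ} [IsFiniteMeasure ρ] {φ : ℝ → ℝ} (hφ : Continuous φ) (g : ℝ) :
    Integrable (fun θ => φ (1 + g * Real.cos θ)) ρ := by
  have := integrable_circ (ρ := ρ) (h := fun z => φ (1 + g * z.re)) (by fun_prop)
  simpa only [re_ctheta] using this

lemma integral_p (g : ℝ) : ∫ θ, (1 + g * Real.cos θ) ∂UNIFm = 1 := by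
  have := mean_weight g (h := fun _ => 1) diffContOnCl_const
  simpa using this

lemma diffContOnCl_log_one_sub {u : ℂ → ℂ} (hu : DiffContOnCl ℂ u (Metric.ball 0 1))
    (h1 : ∀ z ∈ Metric.closedBall (0:ℂ) 1, ‖u z‖ < 1) :
    DiffContOnCl ℂ (fun z => Complex.log (1 - u z)) (Metric.ball 0 1) := by
  have hs : ∀ z ∈ Metric.closedBall (0:ℂ) 1, 1 - u z ∈ Complex.slitPlane := by
    intro z hz
    left
    have := (Complex.re_le_norm (u z)).trans_lt (h1 z hz)
    simp only [Complex.sub_re, Complex.one_re]; linarith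
  constructor
  · intro z hz
    have hd := hu.differentiableOn z hz
    exact (hd.const_sub 1).clog (hs z (Metric.ball_subset_closedBall hz))
  · rw [closure_ball _ one_ne_zero]
    have := hu.continuousOn
    rw [closure_ball _ one_ne_zero] at this
    exact (continuousOn_const.sub this).clog hs

lemma deriv_log_one_sub {u : ℂ → ℂ} {u' : ℂ} (hu : HasDerivAt u u' 0) (h0 : u 0 = 0) :
    deriv (fun z => Complex.log (1 - u z)) 0 = - u' := by
  have h := (hu.const_sub 1).clog (by simp [h0])
  rw [h.deriv]; simp [h0]

lemma entropy_lt {g : ℝ} (hg1 : -1 < g) (hg0 : g ≤ 0) :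
    ∫ θ, (1 + g * Real.cos θ) * Real.log (1 + g * Real.cos θ) ∂UNIFm = Hgw g := by
  set s := Real.sqrt (1 - g^2) with hs
  have hs2 : s^2 = 1 - g^2 := Real.sq_sqrt (by nlinarith)
  have hs0 : 0 ≤ s := Real.sqrt_nonneg _
  set b : ℝ := -g/(1+s) with hb
  have hbs : b * (1+s) = -g := by rw [hb]; field_simp
  have hb0 : 0 ≤ b := by rw [hb]; apply div_nonneg <;> linarith
  have hb1 : b < 1 := by rw [hb, div_lt_one] <;> linarith
  have hgb : -g * b = 1 - s := by
    have : (1+s) * (-g*b) = (1+s)*(1-s) := by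
      calc (1+s) * (-g*b) = -g * (b*(1+s)) := by ring
        _ = _ := by rw [hbs]; linarith
    exact mul_left_cancel₀ (by linarith) this
  have hn : ∀ z ∈ Metric.closedBall (0:ℂ) 1, ‖(b:ℂ) * z‖ < 1 := by
    intro z hz
    rw [norm_mul, Complex.norm_real, Real.norm_of_nonneg hb0]
    have : ‖z‖ ≤ 1 := by simpa using hz
    nlinarith [norm_nonneg z]
  have hd : Differentiable ℂ (fun z : ℂ => (b:ℂ) * z) := by fun_prop
  have hw := mean_weight g (diffContOnCl_log_one_sub hd.diffContOnCl hn)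
  rw [deriv_log_one_sub (u' := (b:ℂ)) (by simpa using (hasDerivAt_id (0:ℂ)).const_mul (b:ℂ)) (by simp)] at hw
  simp only [mul_zero, sub_zero, Complex.log_one, Complex.zero_re, zero_add, Complex.neg_re,
    Complex.ofReal_re, Complex.log_re] at hw
  have e : ∀ θ, (1 + g * Real.cos θ) * Real.log (1 + g * Real.cos θ)
      = (1 + g * Real.cos θ) * Real.log ((1+s)/2)
        + 2 * ((1 + g * Real.cos θ) * Real.log ‖1 - (b:ℂ) * ctheta θ‖) := by
    intro θ
    have hne : ‖1 - (b:ℂ) * ctheta θ‖ ≠ 0 := by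
      rw [norm_ne_zero_iff, sub_ne_zero]
      intro h
      have := hn _ (ctheta_mem θ)
      rw [← h] at this; simp at this
    have : 1 + g * Real.cos θ = (1+s)/2 * ‖1 - (b:ℂ) * ctheta θ‖^2 := by
      rw [← Complex.normSq_eq_norm_sq, Complex.normSq_sub, Complex.normSq_mul,
        Complex.normSq_eq_norm_sq (ctheta θ), norm_ctheta]
      simp only [map_one, Complex.normSq_ofReal, map_mul, Complex.conj_ofReal, one_mul,
        Complex.re_ofReal_mul, Complex.conj_re, re_ctheta]
      linear_combination (Real.cos θ - b/2) * hbs - (1/2) * hgb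
    have hl : Real.log (1 + g * Real.cos θ)
        = Real.log ((1+s)/2) + 2 * Real.log ‖1 - (b:ℂ) * ctheta θ‖ := by
      rw [this, Real.log_mul (by positivity) (by positivity), Real.log_pow]; norm_num
    rw [hl]; ring
  simp_rw [e]
  rw [integral_add, integral_mul_const, integral_const_mul, hw, integral_p, Hgw, ← hs]
  · linarith
  · exact (integrable_cont (φ := fun x => x) (by fun_prop) g).mul_const _
  · apply Integrable.const_mul
    have := integrable_circ (ρ := UNIFm) (h := fun z => (1 + g * z.re) * Real.log ‖1 - (b:ℂ) * z‖) (by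
      apply ContinuousOn.mul (by fun_prop)
      apply ContinuousOn.log (by fun_prop)
      intro z hz
      rw [norm_ne_zero_iff, sub_ne_zero]
      intro h
      have := hn _ hz
      rw [← h] at this; simp at this)
    simpa only [re_ctheta] using this

lemma continuous_Hgw : Continuous Hgw := by
  unfold Hgw
  refine Continuous.add (by fun_prop) (Continuous.log (by fun_prop) ?_)
  intro g
  positivity

lemma entropy {g : ℝ} (hg1 : -1 ≤ g) (hg0 : g ≤ 0) :
    ∫ θ, (1 + g * Real.cos θ) * Real.log (1 + g * Real.cos θ) ∂UNIFm = Hgw g := by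
  rcases hg1.lt_or_eq with h | rfl
  · exact entropy_lt h hg0
  have hc : Continuous fun g : ℝ =>
      ∫ θ, (1 + g * Real.cos θ) * Real.log (1 + g * Real.cos θ) ∂UNIFm := by
    simp_rw [integral_UNIFm]
    refine Continuous.const_smul (c := ((2*π)⁻¹ : ℝ)) ?_
    apply intervalIntegral.continuous_parametric_intervalIntegral_of_continuous'
    have : Continuous fun q : ℝ × ℝ => 1 + q.1 * Real.cos q.2 := by fun_prop
    exact Real.continuous_mul_log.comp this
  have t1 := (hc.tendsto (-1)).mono_left (nhdsWithin_le_nhds (s := Ioi (-1)))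
  have t2 := (continuous_Hgw.tendsto (-1)).mono_left (nhdsWithin_le_nhds (s := Ioi (-1)))
  refine tendsto_nhds_unique t1 (t2.congr' ?_)
  filter_upwards [Ioo_mem_nhdsGT (show (-1:ℝ) < 0 by norm_num)] with x hx
  exact (entropy_lt hx.1 hx.2.le).symm

lemma Hgw_nonpos {g : ℝ} (hg1 : -1 ≤ g) (hg0 : g ≤ 0) : Hgw g + g/2 ≤ 0 := by
  rw [Hgw]
  set s := Real.sqrt (1 - g^2) with hs
  have hs0 : 0 ≤ s := Real.sqrt_nonneg _
  have h1 := Real.log_le_sub_one_of_pos (show 0 < (1+s)/2 by positivity)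
  have h2 : 1 + g ≤ s := Real.le_sqrt_of_sq_le (by nlinarith)
  linarith

lemma KL_GW_UNIF {g : ℝ} (hg1 : -1 ≤ g) (hg0 : g ≤ 0) :
    KLdiv (GWm g) UNIFm = ENNReal.ofReal (Hgw g) := by
  have hm : Measurable fun θ : ℝ => ENNReal.ofReal (1 + g * Real.cos θ) :=
    Measurable.ennreal_ofReal (by fun_prop)
  have hac : GWm g ≪ UNIFm := by rw [GWm_eq hg1 hg0]; exact withDensity_absolutelyContinuous _ _
  have hl : llr (GWm g) UNIFm =ᵐ[UNIFm] fun θ => Real.log (1 + g * Real.cos θ) := by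
    have := Measure.rnDeriv_withDensity UNIFm hm
    rw [← GWm_eq hg1 hg0] at this
    filter_upwards [this] with θ hθ
    rw [llr, hθ, ENNReal.toReal_ofReal (one_add_nonneg hg1 hg0 θ)]
  have hl2 := hac.ae_eq hl
  have hint : Integrable (llr (GWm g) UNIFm) (GWm g) := by
    rw [integrable_congr hl2, GWm_eq hg1 hg0, integrable_withDensity_iff hm (by simp)]
    simp_rw [ENNReal.toReal_ofReal (one_add_nonneg hg1 hg0 _)]
    simp_rw [mul_comm (Real.log _)]
    exact integrable_cont (φ := fun x => x * Real.log x) Real.continuous_mul_log g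
  rw [KLdiv, if_pos ⟨hac, hint⟩, integral_congr_ae hl2, integral_GWm hg1 hg0, entropy hg1 hg0]

/-- Monic polynomials satisfying the Szegő recursion. -/
structure Sz (α : ℕ → ℂ) (Φ : ℕ → ℂ[X]) : Prop where
  lt : ∀ k, ‖α k‖ < 1
  monic : ∀ k, (Φ k).Monic
  deg : ∀ k, (Φ k).natDegree = k
  recu : ∀ k, Φ (k+1) = X * Φ k - C (conj (α k)) * polyStar (Φ k)

lemma coeff_polyStar (P : ℂ[X]) (m : ℕ) :
    (polyStar P).coeff m = conj (P.coeff (revAt P.natDegree m)) := by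
  rw [polyStar, coeff_reverse, natDegree_map, coeff_map]

lemma eval_polyStar (P : ℂ[X]) (θ : ℝ) :
    (polyStar P).eval (ctheta θ) = ctheta θ ^ P.natDegree * conj (P.eval (ctheta θ)) := by
  have hz := ctheta_ne θ
  let _ : Invertible ((ctheta θ)⁻¹) := invertibleOfNonzero (inv_ne_zero hz)
  have h := eval₂_reverse_mul_pow (RingHom.id ℂ) ((ctheta θ)⁻¹) (P.map (starRingEnd ℂ))
  rw [natDegree_map, invOf_eq_inv, inv_inv] at h
  have h2 : (P.map (starRingEnd ℂ)).eval (conj (ctheta θ)) = conj (P.eval (ctheta θ)) := by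
    rw [eval_map, eval₂_hom]
  rw [← h2, conj_ctheta]
  change eval₂ (RingHom.id ℂ) _ (P.map (starRingEnd ℂ)).reverse = _ * eval₂ (RingHom.id ℂ) _ _
  rw [← h, mul_comm, mul_assoc, ← mul_pow, inv_mul_cancel₀ hz, one_pow, mul_one]

namespace Sz
variable {α : ℕ → ℂ} {Φ : ℕ → ℂ[X]}

lemma zero (h : Sz α Φ) : Φ 0 = 1 := eq_one_of_monic_natDegree_zero (h.monic 0) (h.deg 0)

lemma star_succ (h : Sz α Φ) (k : ℕ) :
    polyStar (Φ (k+1)) = polyStar (Φ k) - C (α k) * (X * Φ k) := by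
  ext m
  rw [coeff_polyStar, h.deg, coeff_sub, coeff_C_mul, coeff_polyStar, h.deg]
  rcases le_or_gt m (k+1) with hm | hm
  · rw [revAt_le hm, h.recu, coeff_sub, coeff_C_mul, coeff_polyStar, h.deg]
    rcases m with _ | m
    · have : (Φ k).coeff (k+1) = 0 := coeff_eq_zero_of_natDegree_lt (by rw [h.deg]; omega)
      rw [revAt_eq_self_of_lt (by omega : k < k + 1 - 0), revAt_le (Nat.zero_le k)]
      simp [this]
    · have hm' : m ≤ k := by omega
      rw [coeff_X_mul, revAt_le (show k + 1 - (m+1) ≤ k by omega)]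
      have e1 : k - (k + 1 - (m+1)) = m := by omega
      rw [e1]
      rcases hm'.lt_or_eq with hlt | rfl
      · have e2 : k + 1 - (m+1) = (k - (m+1)) + 1 := by omega
        rw [e2, coeff_X_mul, revAt_le (by omega : m + 1 ≤ k)]
        simp
      · have : (Φ m).coeff (m+1) = 0 := coeff_eq_zero_of_natDegree_lt (by rw [h.deg]; omega)
        rw [revAt_eq_self_of_lt (by omega : m < m + 1)]
        simp [this]
  · obtain ⟨m, rfl⟩ : ∃ j, m = j + 1 := ⟨m - 1, by omega⟩
    rw [revAt_eq_self_of_lt hm, revAt_eq_self_of_lt (by omega), coeff_X_mul,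
      coeff_eq_zero_of_natDegree_lt (by rw [h.deg]; omega),
      coeff_eq_zero_of_natDegree_lt (by rw [h.deg]; omega),
      coeff_eq_zero_of_natDegree_lt (by rw [h.deg]; omega)]
    simp

lemma star_zero_coeff (h : Sz α Φ) (k : ℕ) : (polyStar (Φ k)).eval 0 = 1 := by
  rw [← coeff_zero_eq_eval_zero, coeff_polyStar, h.deg, revAt_le (Nat.zero_le k)]
  have := (h.monic k).coeff_natDegree
  rw [h.deg] at this
  simp [this]

lemma eval_zero (h : Sz α Φ) (k : ℕ) : (Φ (k+1)).eval 0 = - conj (α k) := by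
  rw [h.recu]; simp [h.star_zero_coeff]

lemma bound (h : Sz α Φ) (n : ℕ) {z : ℂ} (hz : ‖z‖ ≤ 1) :
    ‖(Φ n).eval z‖ ≤ ‖(polyStar (Φ n)).eval z‖ ∧ (polyStar (Φ n)).eval z ≠ 0 := by
  induction n with
  | zero =>
    rw [h.zero]; simp [polyStar, ← C_1, -map_one]
  | succ n ih =>
    rw [h.star_succ, h.recu]
    simp only [eval_sub, eval_mul, eval_X, eval_C]
    set a := (polyStar (Φ n)).eval z
    set b := z * (Φ n).eval z with hb
    have hba : ‖b‖ ≤ ‖a‖ := by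
      rw [hb, norm_mul]
      nlinarith [ih.1, norm_nonneg ((Φ n).eval z)]
    have ha : 0 < ‖a‖ := norm_pos_iff.2 ih.2
    have hl := h.lt n
    constructor
    · have e : ‖a - α n * b‖^2 - ‖b - conj (α n) * a‖^2 = (1 - ‖α n‖^2) * (‖a‖^2 - ‖b‖^2) := by
        simp only [← Complex.normSq_eq_norm_sq, Complex.normSq_apply, Complex.sub_re,
          Complex.sub_im, Complex.mul_re, Complex.mul_im, Complex.conj_re, Complex.conj_im]
        ring
      have : 0 ≤ (1 - ‖α n‖^2) * (‖a‖^2 - ‖b‖^2) := by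
        apply mul_nonneg <;> nlinarith [norm_nonneg (α n), norm_nonneg b]
      exact abs_le_of_sq_le_sq' (by linarith) (norm_nonneg _) |>.2
    · intro h0
      have : ‖a‖ = ‖α n‖ * ‖b‖ := by rw [← norm_mul, sub_eq_zero.1 h0]
      nlinarith [norm_nonneg (α n), norm_nonneg b]

lemma norm_eq (n : ℕ) (θ : ℝ) :
    ‖(polyStar (Φ n)).eval (ctheta θ)‖ = ‖(Φ n).eval (ctheta θ)‖ := by
  rw [eval_polyStar, norm_mul, norm_pow, norm_ctheta]; simp

lemma ne_zero (h : Sz α Φ) (n : ℕ) (θ : ℝ) : (Φ n).eval (ctheta θ) ≠ 0 := by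
  rw [← norm_ne_zero_iff, ← norm_eq, norm_ne_zero_iff]
  exact (h.bound n (norm_ctheta θ).le).2

end Sz

/-- the product of `1 - |α_j|²`, `j < n` -/
def Nn (α : ℕ → ℂ) (n : ℕ) : ℝ := ∏ j ∈ Finset.range n, (1 - ‖α j‖^2)

lemma Nn_pos {α : ℕ → ℂ} (h : ∀ k, ‖α k‖ < 1) (n : ℕ) : 0 < Nn α n := by
  apply Finset.prod_pos
  intro j _
  nlinarith [h j, norm_nonneg (α j)]

/-- Bernstein–Szegő weight -/
def wn (α : ℕ → ℂ) (Φ : ℕ → ℂ[X]) (n : ℕ) (θ : ℝ) : ℝ := Nn α n / ‖(Φ n).eval (ctheta θ)‖^2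

section wn
variable {α : ℕ → ℂ} {Φ : ℕ → ℂ[X]}

lemma continuous_evalc (P : ℂ[X]) : Continuous fun θ => P.eval (ctheta θ) :=
  P.continuous.comp continuous_ctheta

lemma wn_pos (h : Sz α Φ) (n : ℕ) (θ : ℝ) : 0 < wn α Φ n θ :=
  div_pos (Nn_pos h.lt n) (pow_pos (norm_pos_iff.2 (h.ne_zero n θ)) 2)

lemma wn_eq (n : ℕ) (θ : ℝ) :
    wn α Φ n θ = Nn α n / ‖(polyStar (Φ n)).eval (ctheta θ)‖^2 := by rw [wn, Sz.norm_eq]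

lemma continuous_wn (h : Sz α Φ) (n : ℕ) : Continuous (wn α Φ n) := by
  unfold wn
  refine continuous_const.div ((continuous_evalc _).norm.pow 2) fun θ => ?_
  have := h.ne_zero n θ
  positivity

/-- the density as a function on the closed disk -/
lemma continuousOn_W (h : Sz α Φ) (n : ℕ) : ContinuousOn
    (fun z => Nn α n / ‖(polyStar (Φ n)).eval z‖^2) (Metric.closedBall 0 1) := by
  refine continuousOn_const.div (by fun_prop) fun z hz => ?_
  have := (h.bound n (z := z) (by simpa using hz)).2
  positivity

lemma bdd_wn (h : Sz α Φ) (n : ℕ) : ∃ a b, 0 < a ∧ ∀ θ, wn α Φ n θ ∈ Icc a b := by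
  have hc := continuousOn_W h n
  have hK := isCompact_closedBall (0:ℂ) 1
  have hne : (Metric.closedBall (0:ℂ) 1).Nonempty := ⟨0, by simp⟩
  obtain ⟨x, hx, hx'⟩ := hK.exists_isMinOn hne hc
  obtain ⟨y, hy, hy'⟩ := hK.exists_isMaxOn hne hc
  refine ⟨Nn α n / ‖(polyStar (Φ n)).eval x‖^2, Nn α n / ‖(polyStar (Φ n)).eval y‖^2, ?_,
    fun θ => ?_⟩
  rotate_left
  · rw [wn_eq]
    exact ⟨hx' (ctheta_mem θ), hy' (ctheta_mem θ)⟩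
  · have h1 := (h.bound n (z := x) (by simpa using hx)).2
    have := Nn_pos h.lt n
    positivity

/-- Bernstein–Szegő measure -/
def rhon (α : ℕ → ℂ) (Φ : ℕ → ℂ[X]) (n : ℕ) : Measure ℝ :=
  UNIFm.withDensity fun θ => ENNReal.ofReal (wn α Φ n θ)

lemma integral_rhon (h : Sz α Φ) (n : ℕ) {E : Type*} [NormedAddCommGroup E] [NormedSpace ℝ E]
    (f : ℝ → E) : ∫ θ, f θ ∂(rhon α Φ n) = ∫ θ, wn α Φ n θ • f θ ∂UNIFm := by
  rw [rhon, integral_withDensity_eq_integral_toReal_smul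
    (Measurable.ennreal_ofReal (continuous_wn h n).measurable) (by simp)]
  simp_rw [ENNReal.toReal_ofReal (wn_pos h n _).le]

lemma isFinite_rhon (h : Sz α Φ) (n : ℕ) : IsFiniteMeasure (rhon α Φ n) := by
  refine isFiniteMeasure_withDensity_ofReal (f := wn α Φ n) ?_
  obtain ⟨a, b, ha, hab⟩ := bdd_wn h n
  exact (Integrable.of_bound (continuous_wn h n).aestronglyMeasurable b
    (Eventually.of_forall fun θ => by
      rw [Real.norm_of_nonneg (wn_pos h n θ).le]; exact (hab θ).2)).2

end wn

lemma integrable_pp (ρ : Measure ℝ) [IsFiniteMeasure ρ] (Q P : ℂ[X]) :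
    Integrable (fun θ => conj (Q.eval (ctheta θ)) * P.eval (ctheta θ)) ρ :=
  integrable_circ (h := fun z => conj (Q.eval z) * P.eval z)
    ((Complex.continuous_conj.comp Q.continuous).mul P.continuous).continuousOn

/-- inner product -/
def Ip (ρ : Measure ℝ) [IsFiniteMeasure ρ] (Q : ℂ[X]) : ℂ[X] →ₗ[ℂ] ℂ where
  toFun P := ∫ θ, conj (Q.eval (ctheta θ)) * P.eval (ctheta θ) ∂ρ
  map_add' P R := by
    rw [← integral_add (integrable_pp ρ Q P) (integrable_pp ρ Q R)]
    simp only [eval_add, mul_add]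
  map_smul' c P := by
    rw [RingHom.id_apply, smul_eq_mul, ← integral_const_mul]
    simp only [eval_smul, smul_eq_mul]
    congr 1; funext θ; ring

lemma Ip_apply (ρ : Measure ℝ) [IsFiniteMeasure ρ] (Q P : ℂ[X]) :
    Ip ρ Q P = ∫ θ, conj (Q.eval (ctheta θ)) * P.eval (ctheta θ) ∂ρ := rfl

lemma Ip_C_mul (ρ : Measure ℝ) [IsFiniteMeasure ρ] (Q P : ℂ[X]) (c : ℂ) :
    Ip ρ Q (C c * P) = c * Ip ρ Q P := by
  rw [← smul_eq_C_mul, map_smul, smul_eq_mul]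

lemma Ip_symm (ρ : Measure ℝ) [IsFiniteMeasure ρ] (Q P : ℂ[X]) :
    conj (Ip ρ Q P) = Ip ρ P Q := by
  rw [Ip_apply, Ip_apply, ← integral_conj]
  congr 1; funext θ; simp [mul_comm]

lemma conj_mul_self_ctheta (θ : ℝ) : conj (ctheta θ) * ctheta θ = 1 := by
  rw [conj_ctheta, inv_mul_cancel₀ (ctheta_ne θ)]

lemma Ip_X_mul (ρ : Measure ℝ) [IsFiniteMeasure ρ] (Q P : ℂ[X]) :
    Ip ρ (X * Q) (X * P) = Ip ρ Q P := by
  rw [Ip_apply, Ip_apply]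
  congr 1; funext θ
  simp only [eval_mul, eval_X, map_mul]
  linear_combination (conj (Q.eval (ctheta θ)) * P.eval (ctheta θ)) * conj_mul_self_ctheta θ

lemma Ip_star (ρ : Measure ℝ) [IsFiniteMeasure ρ] (P : ℂ[X]) {i : ℕ} (hi : i ≤ P.natDegree) :
    Ip ρ (X^i) (polyStar P) = conj (Ip ρ (X^(P.natDegree - i)) P) := by
  rw [Ip_symm, Ip_apply, Ip_apply]
  congr 1; funext θ
  rw [eval_polyStar]
  simp only [eval_pow, eval_X, map_pow]
  obtain ⟨m, hm⟩ := Nat.exists_eq_add_of_le hi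
  rw [hm, Nat.add_sub_cancel_left, pow_add]
  have : conj (ctheta θ) ^ i * ctheta θ ^ i = 1 := by
    rw [← mul_pow, conj_mul_self_ctheta, one_pow]
  linear_combination (ctheta θ ^ m * conj (P.eval (ctheta θ))) * this

lemma lin_zero {Φ : ℕ → ℂ[X]} (hm : ∀ k, (Φ k).Monic) (hd : ∀ k, (Φ k).natDegree = k)
    (L : ℂ[X] →ₗ[ℂ] ℂ) (n : ℕ) (hL : ∀ j < n, L (Φ j) = 0) :
    ∀ j ≤ n, ∀ P : ℂ[X], P.degree < j → L P = 0 := by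
  intro j
  induction j with
  | zero =>
    intro _ P hP
    have : P = 0 := by
      rw [← degree_eq_bot]
      simpa [Nat.WithBot.lt_zero_iff] using hP
    rw [this, map_zero]
  | succ j ih =>
    intro hj P hP
    have hP' : P.natDegree ≤ j := by
      rw [natDegree_le_iff_coeff_eq_zero]
      intro m hmj
      exact (degree_lt_iff_coeff_zero P (j+1)).1 hP m hmj
    have key : (P - P.coeff j • Φ j).degree < j := by
      rw [degree_lt_iff_coeff_zero]
      intro m hm'
      rcases (show j = m ∨ j < m by omega) with rfl | hlt
      · have := (hm j).coeff_natDegree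
        rw [hd] at this
        simp [this]
      · rw [coeff_sub, coeff_smul,
          coeff_eq_zero_of_natDegree_lt (show P.natDegree < m by omega),
          coeff_eq_zero_of_natDegree_lt (show (Φ j).natDegree < m by rw [hd]; omega)]
        simp
    have := ih (by omega) _ key
    rw [map_sub, map_smul, hL j (by omega), smul_zero, sub_zero] at this
    exact this

section match_moments
variable {α : ℕ → ℂ} {Φ : ℕ → ℂ[X]}

lemma orth_nu (h : Sz α Φ) (ν : Measure ℝ) [IsFiniteMeasure ν]
    (ho : ∀ j k, j ≠ k → Ip ν (Φ j) (Φ k) = 0) {i k : ℕ} (hik : i < k) :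
    Ip ν (X^i) (Φ k) = 0 := by
  have := lin_zero h.monic h.deg (Ip ν (Φ k)) k (fun j hj => ho k j (by omega)) k le_rfl (X^i)
    (by rw [degree_X_pow]; exact_mod_cast hik)
  rw [← Ip_symm, this, map_zero]

lemma orth_one (h : Sz α Φ) (ν : Measure ℝ) [IsFiniteMeasure ν]
    (ho : ∀ j k, j ≠ k → Ip ν (Φ j) (Φ k) = 0) (n : ℕ) :
    Ip ν 1 (X * Φ n) = conj (α n) * conj (Ip ν (X^n) (Φ n)) := by
  have h0 := orth_nu h ν ho (Nat.succ_pos n)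
  rw [pow_zero, Nat.succ_eq_add_one, h.recu, map_sub, Ip_C_mul, sub_eq_zero] at h0
  have h1 := Ip_star ν (Φ n) (Nat.zero_le _)
  rw [h.deg, pow_zero, Nat.sub_zero] at h1
  rw [h0, h1]

lemma norm_nu (h : Sz α Φ) (ν : Measure ℝ) [IsProbabilityMeasure ν]
    (ho : ∀ j k, j ≠ k → Ip ν (Φ j) (Φ k) = 0) (n : ℕ) :
    Ip ν (X^n) (Φ n) = Nn α n := by
  induction n with
  | zero => rw [h.zero, Ip_apply]; simp [Nn]
  | succ n ih =>
    have h1 := orth_one h ν ho n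
    have h2 : Ip ν (X^(n+1)) (polyStar (Φ n)) = conj (Ip ν 1 (X * Φ n)) := by
      rw [Ip_symm, Ip_apply, Ip_apply]
      congr 1; funext θ
      rw [eval_polyStar, h.deg]
      simp only [eval_pow, eval_X, map_pow, eval_mul, map_mul, eval_one, mul_one]
      have : conj (ctheta θ) ^ n * ctheta θ ^ n = 1 := by
        rw [← mul_pow, conj_mul_self_ctheta, one_pow]
      rw [pow_succ]
      linear_combination (conj (ctheta θ) * conj ((Φ n).eval (ctheta θ))) * this
    rw [h.recu, map_sub, Ip_C_mul, h2, h1, pow_succ', Ip_X_mul, ih]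
    simp only [map_mul, Complex.conj_conj, Complex.conj_ofReal]
    rw [Nn, Nn, Finset.prod_range_succ]
    push_cast
    have : conj (α n) * α n = (‖α n‖:ℂ)^2 := by rw [mul_comm, Complex.mul_conj']
    linear_combination - (∏ x ∈ Finset.range n, (1 - (‖α x‖:ℂ)^2)) * this

lemma orth_rho (h : Sz α Φ) (n : ℕ) [IsFiniteMeasure (rhon α Φ n)] {i : ℕ} (hi : i ≤ n) :
    Ip (rhon α Φ n) (X^i) (Φ n) = if i = n then (Nn α n : ℂ) else 0 := by
  rw [Ip_apply, integral_rhon h]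
  obtain ⟨m, rfl⟩ := Nat.exists_eq_add_of_le hi
  have hd : DiffContOnCl ℂ (fun z => (Nn α (i+m) : ℂ) * (z^m / (polyStar (Φ (i+m))).eval z))
      (Metric.ball 0 1) := by
    apply DifferentiableOn.diffContOnCl
    rw [closure_ball _ one_ne_zero]
    apply DifferentiableOn.const_mul
    apply DifferentiableOn.div (by fun_prop) (by fun_prop)
    intro z hz
    exact (h.bound _ (by simpa using hz)).2
  have hmv := mean_value hd
  rw [h.star_zero_coeff] at hmv
  calc _ = _ := ?_
    _ = _ := hmv
    _ = _ := by
      rcases m with _ | m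
      · simp
      · simp
  congr 1; funext θ
  have hz := ctheta_ne θ
  have hne := h.ne_zero (i+m) θ
  have hne' : conj ((Φ (i+m)).eval (ctheta θ)) ≠ 0 := by simpa using hne
  rw [wn, eval_polyStar, h.deg, Complex.real_smul]
  push_cast
  rw [← Complex.mul_conj', pow_add]
  simp only [eval_pow, eval_X, map_pow, conj_ctheta, inv_pow]
  field_simp

lemma back (h : Sz α Φ) (ν : Measure ℝ) [IsProbabilityMeasure ν]
    (ho : ∀ j k, j ≠ k → Ip ν (Φ j) (Φ k) = 0) (n : ℕ) [IsFiniteMeasure (rhon α Φ n)] :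
    ∀ k j, j + k = n → ∀ i ≤ j, Ip ν (X^i) (Φ j) = Ip (rhon α Φ n) (X^i) (Φ j) := by
  intro k
  induction k with
  | zero =>
    intro j hj i hi
    obtain rfl : j = n := by omega
    rw [orth_rho h j hi]
    split_ifs with hij
    · rw [hij, norm_nu h ν ho]
    · exact orth_nu h ν ho (by omega)
  | succ k ih =>
    intro j hj i hi
    have ih' := ih (j+1) (by omega)
    have e : C ((1 - ‖α j‖^2 : ℝ) : ℂ) * (X * Φ j)
        = Φ (j+1) + C (conj (α j)) * polyStar (Φ (j+1)) := by
      have : C ((1 - ‖α j‖^2 : ℝ) : ℂ) = 1 - C (conj (α j)) * C (α j) := by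
        rw [← C_mul, mul_comm, Complex.mul_conj']; simp
      rw [h.star_succ, h.recu, this]; ring
    have hpos : ((1 - ‖α j‖^2 : ℝ) : ℂ) ≠ 0 := by
      have := h.lt j
      rw [Complex.ofReal_ne_zero]
      nlinarith [norm_nonneg (α j)]
    have key : ∀ (ρ : Measure ℝ) [IsFiniteMeasure ρ], ((1 - ‖α j‖^2 : ℝ) : ℂ) * Ip ρ (X^i) (Φ j)
        = Ip ρ (X^(i+1)) (Φ (j+1)) + conj (α j) * conj (Ip ρ (X^(j-i)) (Φ (j+1))) := by
      intro ρ _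
      have hs := Ip_star ρ (Φ (j+1)) (i := i+1) (by rw [h.deg]; omega)
      rw [h.deg, show j + 1 - (i+1) = j - i by omega] at hs
      rw [← Ip_X_mul ρ (X^i), ← Ip_C_mul, ← pow_succ', e, map_add, Ip_C_mul, hs]
    have k1 := key ν
    have k2 := key (rhon α Φ n)
    rw [ih' (i+1) (by omega), ih' (j-i) (by omega), ← k2] at k1
    exact mul_left_cancel₀ hpos k1

lemma match_poly (h : Sz α Φ) (ν : Measure ℝ) [IsProbabilityMeasure ν]
    (ho : ∀ j k, j ≠ k → Ip ν (Φ j) (Φ k) = 0) (n j : ℕ) (hj : j ≤ n) :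
    ∫ θ, ctheta θ ^ j ∂ν = ∫ θ, ctheta θ ^ j ∂(rhon α Φ n) := by
  have := isFinite_rhon h n
  have := lin_zero h.monic h.deg (Ip ν 1 - Ip (rhon α Φ n) 1) (n+1) (fun j hj => by
    rw [LinearMap.sub_apply, sub_eq_zero]
    exact back h ν ho n (n - j) j (by omega) 0 (by omega)) (n+1) le_rfl (X^j) (by
      rw [degree_X_pow]; exact_mod_cast (by omega : j < n+1))
  rw [LinearMap.sub_apply, sub_eq_zero, Ip_apply, Ip_apply] at this
  simpa using this

lemma fourier_ctheta (n : ℤ) (θ : ℝ) :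
    (fourier n : C(AddCircle (2*π), ℂ)) (θ : AddCircle (2*π)) = ctheta θ ^ n := by
  rw [fourier_coe_apply, ctheta, ← Complex.exp_int_mul]
  congr 1
  have : (π:ℂ) ≠ 0 := by exact_mod_cast Real.pi_ne_zero
  push_cast
  field_simp

lemma match_fourier (h : Sz α Φ) (ν : Measure ℝ) [IsProbabilityMeasure ν]
    (ho : ∀ j k, j ≠ k → Ip ν (Φ j) (Φ k) = 0) (q : C(AddCircle (2*π), ℂ))
    (hq : q ∈ Submodule.span ℂ (range (fun n:ℤ => (fourier n : C(AddCircle (2*π),ℂ))))) :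
    ∀ᶠ n in atTop, ∫ θ : ℝ, q (θ : AddCircle (2*π)) ∂ν
      = ∫ θ : ℝ, q (θ : AddCircle (2*π)) ∂(rhon α Φ n) := by
  have hint : ∀ (ρ : Measure ℝ) [IsFiniteMeasure ρ] (q : C(AddCircle (2*π), ℂ)),
      Integrable (fun θ : ℝ => q (θ : AddCircle (2*π))) ρ := by
    intro ρ _ q
    have := fact_two_pi
    refine Integrable.of_bound ?_ ‖q‖ (Eventually.of_forall fun θ => q.norm_coe_le_norm _)
    exact (q.continuous.comp (AddCircle.continuous_mk' _)).aestronglyMeasurable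
  induction hq using Submodule.span_induction with
  | mem q hq =>
    obtain ⟨k, rfl⟩ := hq
    filter_upwards [eventually_ge_atTop k.natAbs] with n hn
    simp only [fourier_ctheta]
    have := match_poly h ν ho n k.natAbs hn
    simp only [← zpow_natCast] at this
    rcases Int.natAbs_eq k with hk | hk
    · rw [hk]; exact this
    · rw [hk]
      have h2 := congrArg conj this
      rw [← integral_conj, ← integral_conj] at h2
      simpa only [map_zpow₀, conj_ctheta, inv_zpow', inv_zpow] using h2
  | zero => simp
  | add q r _ _ h1 h2 =>
    filter_upwards [h1, h2] with n h1 h2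
    have := isFinite_rhon h n
    simp only [ContinuousMap.add_apply]
    rw [integral_add (hint _ _) (hint _ _), integral_add (hint _ _) (hint _ _), h1, h2]
  | smul c q _ h1 =>
    filter_upwards [h1] with n h1
    simp only [ContinuousMap.smul_apply]
    rw [integral_smul, integral_smul, h1]

/-- `∫ z |Φ_n|² dν` -/
lemma shift_nu (h : Sz α Φ) (ν : Measure ℝ) [IsProbabilityMeasure ν]
    (ho : ∀ j k, j ≠ k → Ip ν (Φ j) (Φ k) = 0) (n : ℕ) :
    Ip ν (Φ n) (X * Φ n) = conj (α n) * conj ((Φ n).eval 0) * Nn α n := by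
  have h1 : X * Φ n = Φ (n+1) + C (conj (α n)) * polyStar (Φ n) := by rw [h.recu]; ring
  rw [h1, map_add, Ip_C_mul, ho n (n+1) (by omega), zero_add, ← Ip_symm, mul_assoc]
  congr 1
  -- reduce to the constant coefficient
  have hstar : ∀ i ≤ n, Ip ν (polyStar (Φ n)) (X^i) = if i = 0 then (Nn α n : ℂ) else 0 := by
    intro i hi
    have := Ip_star ν (Φ n) (i := i) (by rw [h.deg]; exact hi)
    rw [h.deg] at this
    rw [← Ip_symm, this, Complex.conj_conj]
    split_ifs with h0
    · rw [h0, Nat.sub_zero, norm_nu h ν ho]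
    · exact orth_nu h ν ho (by omega)
  have : Ip ν (polyStar (Φ n)) (Φ n) = (Φ n).eval 0 * Nn α n := by
    conv_lhs => rhs; rw [(Φ n).as_sum_range_C_mul_X_pow]
    rw [map_sum, h.deg, Finset.sum_eq_single 0]
    · rw [Ip_C_mul, hstar 0 (Nat.zero_le _), if_pos rfl, coeff_zero_eq_eval_zero]
    · intro i hi h0
      rw [Finset.mem_range] at hi
      rw [Ip_C_mul, hstar i (by omega), if_neg h0, mul_zero]
    · intro h; simp at h
  rw [this]; simp

lemma norm_sq_nu (h : Sz α Φ) (ν : Measure ℝ) [IsProbabilityMeasure ν]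
    (ho : ∀ j k, j ≠ k → Ip ν (Φ j) (Φ k) = 0) (n : ℕ) :
    Ip ν (Φ n) (Φ n) = Nn α n := by
  have : Ip ν (Φ n) (Φ n - X^n) = 0 := by
    refine lin_zero h.monic h.deg (Ip ν (Φ n)) n (fun j hj => ho n j (by omega)) n le_rfl _ ?_
    rw [degree_lt_iff_coeff_zero]
    intro m hm
    rw [coeff_sub, coeff_X_pow]
    split_ifs with hmn
    · have := (h.monic n).coeff_natDegree
      rw [h.deg] at this
      rw [hmn, this, sub_self]
    · rw [coeff_eq_zero_of_natDegree_lt (by rw [h.deg]; omega), sub_zero]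
  rw [map_sub, sub_eq_zero] at this
  rw [this, ← Ip_symm, norm_nu h ν ho, Complex.conj_ofReal]

end match_moments

/-- `α_{k-1}` with `α_{-1} = -1` -/
def pv (α : ℕ → ℂ) (k : ℕ) : ℂ := if k = 0 then -1 else α (k-1)

/-- the `k`-th term of the sum -/
def tk (g : ℝ) (α : ℕ → ℂ) (k : ℕ) : ℝ :=
  -(g/2) * ‖α k - pv α k‖^2 + (-Real.log (1 - ‖α k‖^2) + g * ‖α k‖^2)

lemma integrable_UNIF {f : ℝ → ℝ} (hf : Continuous f) : Integrable f UNIFm := by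
  rw [UNIFm_eq]
  apply Integrable.smul_measure _ (by simp)
  exact (hf.integrableOn_Icc (a := 0) (b := 2*π)).mono_set Ico_subset_Icc_self

section An
variable {α : ℕ → ℂ} {Φ : ℕ → ℂ[X]}

lemma Sz.eval_zero' (h : Sz α Φ) (k : ℕ) : (Φ k).eval 0 = - conj (pv α k) := by
  rcases k with _ | k
  · rw [h.zero]; simp [pv]
  · rw [h.eval_zero]; simp [pv]

lemma cont_plog (h : Sz α Φ) (g : ℝ) (n : ℕ) :
    Continuous fun θ => (1 + g * Real.cos θ) * Real.log (wn α Φ n θ) :=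
  (by fun_prop : Continuous fun θ => 1 + g * Real.cos θ).mul
    ((continuous_wn h n).log fun θ => (wn_pos h n θ).ne')

lemma Ln_eq (h : Sz α Φ) (g : ℝ) (n : ℕ) :
    ∫ θ, (1 + g * Real.cos θ) * Real.log (wn α Φ n θ) ∂UNIFm
      = ∑ j ∈ Finset.range n, (Real.log (1 - ‖α j‖^2) - g * (α j * conj (pv α j)).re) := by
  induction n with
  | zero => simp [wn, Nn, h.zero]
  | succ n ih =>
    rw [Finset.sum_range_succ, ← ih]
    set u : ℂ → ℂ := fun z => α n * (z * (Φ n).eval z / (polyStar (Φ n)).eval z) with hu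
    have hud : DifferentiableOn ℂ u (Metric.closedBall 0 1) := by
      apply DifferentiableOn.const_mul
      apply DifferentiableOn.div (by fun_prop) (by fun_prop)
      intro z hz
      exact (h.bound n (by simpa using hz)).2
    have hu1 : ∀ z ∈ Metric.closedBall (0:ℂ) 1, ‖u z‖ < 1 := by
      intro z hz
      have hz' : ‖z‖ ≤ 1 := by simpa using hz
      obtain ⟨b1, b2⟩ := h.bound n hz'
      have b3 : 0 < ‖(polyStar (Φ n)).eval z‖ := norm_pos_iff.2 b2
      have : ‖z * (Φ n).eval z / (polyStar (Φ n)).eval z‖ ≤ 1 := by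
        rw [norm_div, norm_mul, div_le_one b3]
        nlinarith [norm_nonneg ((Φ n).eval z)]
      rw [hu]
      simp only
      rw [norm_mul]
      nlinarith [h.lt n, norm_nonneg (α n)]
    have hu0 : u 0 = 0 := by simp [hu]
    have hu' : HasDerivAt u (α n * (Φ n).eval 0) 0 := by
      have d1 : HasDerivAt (fun z => (Φ n).eval z / (polyStar (Φ n)).eval z) _ 0 :=
        ((Φ n).hasDerivAt 0).div ((polyStar (Φ n)).hasDerivAt 0)
          (by rw [h.star_zero_coeff]; exact one_ne_zero)
      have d2 := ((hasDerivAt_id (0:ℂ)).mul d1).const_mul (α n)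
      refine (d2.congr_deriv ?_).congr_of_eventuallyEq (Eventually.of_forall fun z => ?_)
      · simp [h.star_zero_coeff]
      · simp [hu, mul_div_assoc]
    have hdc : DiffContOnCl ℂ u (Metric.ball 0 1) :=
      DifferentiableOn.diffContOnCl (by rwa [closure_ball _ one_ne_zero])
    have hlog := diffContOnCl_log_one_sub hdc hu1
    have hw := mean_weight g hlog
    rw [deriv_log_one_sub hu' hu0, h.eval_zero'] at hw
    simp only [hu0, sub_zero, Complex.log_one, Complex.zero_re, zero_add, Complex.log_re] at hw
    have hl := h.lt n
    have h1 : 0 < 1 - ‖α n‖^2 := by nlinarith [norm_nonneg (α n)]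
    have e : ∀ θ, (1 + g * Real.cos θ) * Real.log (wn α Φ (n+1) θ)
        = (1 + g * Real.cos θ) * Real.log (wn α Φ n θ)
          + (1 + g * Real.cos θ) * Real.log (1 - ‖α n‖^2)
          - 2 * ((1 + g * Real.cos θ) * Real.log ‖1 - u (ctheta θ)‖) := by
      intro θ
      have hb := (h.bound n (norm_ctheta θ).le).2
      have hb' := (h.bound (n+1) (norm_ctheta θ).le).2
      have hs : (polyStar (Φ (n+1))).eval (ctheta θ)
          = (polyStar (Φ n)).eval (ctheta θ) * (1 - u (ctheta θ)) := by
        rw [h.star_succ, hu]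
        simp only [eval_sub, eval_mul, eval_C, eval_X]
        field_simp
      have hune : ‖1 - u (ctheta θ)‖ ≠ 0 := by
        intro h0
        rw [norm_eq_zero] at h0
        rw [hs, h0, mul_zero] at hb'
        exact hb' rfl
      have hN : Nn α (n+1) = Nn α n * (1 - ‖α n‖^2) := Finset.prod_range_succ _ _
      have : wn α Φ (n+1) θ = wn α Φ n θ * (1 - ‖α n‖^2) / ‖1 - u (ctheta θ)‖^2 := by
        rw [wn_eq, wn_eq, hs, norm_mul, hN, mul_pow]
        have := norm_ne_zero_iff.2 hb
        field_simp
      have hwp := (wn_pos h n θ).ne'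
      rw [this, Real.log_div (mul_ne_zero hwp h1.ne') (pow_ne_zero 2 hune),
        Real.log_mul hwp h1.ne', Real.log_pow]
      push_cast; ring
    have i1 := integrable_UNIF (cont_plog h g n)
    have i2 : Integrable (fun θ => (1 + g * Real.cos θ) * Real.log (1 - ‖α n‖^2)) UNIFm :=
      integrable_UNIF (by fun_prop)
    have i3 : Integrable (fun θ => 2 * ((1 + g * Real.cos θ) * Real.log ‖1 - u (ctheta θ)‖))
        UNIFm := by
      apply Integrable.const_mul
      have := integrable_circ (ρ := UNIFm) (h := fun z => (1 + g * z.re) * Real.log ‖1 - u z‖) (by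
        apply ContinuousOn.mul (by fun_prop)
        have := hud.continuousOn
        apply ContinuousOn.log (by fun_prop)
        intro z hz
        rw [norm_ne_zero_iff, sub_ne_zero]
        intro h
        have := hu1 _ hz
        rw [← h] at this; simp at this)
      simpa only [re_ctheta] using this
    simp_rw [e]
    have i12 : Integrable (fun θ => (1 + g * Real.cos θ) * Real.log (wn α Φ n θ)
      + (1 + g * Real.cos θ) * Real.log (1 - ‖α n‖^2)) UNIFm := i1.add i2
    rw [integral_sub i12 i3, integral_add i1 i2, integral_const_mul, hw,
      integral_mul_const, integral_p]
    simp
    ring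

lemma An_eq (h : Sz α Φ) (g : ℝ) (n : ℕ) :
    Hgw g - ∫ θ, (1 + g * Real.cos θ) * Real.log (wn α Φ n θ) ∂UNIFm
      = Hgw g + g/2 + ∑ k ∈ Finset.range n, tk g α k - g/2 * ‖pv α n‖^2 := by
  rw [Ln_eq h]
  induction n with
  | zero => simp [pv]
  | succ n ih =>
    rw [Finset.sum_range_succ, Finset.sum_range_succ]
    have : ‖α n - pv α n‖^2 = ‖α n‖^2 + ‖pv α n‖^2 - 2 * (α n * conj (pv α n)).re := by
      simp only [← Complex.normSq_eq_norm_sq, Complex.normSq_sub]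
    have hp : pv α (n+1) = α n := by simp [pv]
    rw [hp, tk, this]
    linarith

/-- upper bound, pointwise form -/
lemma pointwise_ineq {p T w : ℝ} (hp : 0 ≤ p) (hT : 0 < T) (hw : 0 < w) :
    p * Real.log T - w * T + p ≤ p * Real.log p - p * Real.log w := by
  rcases hp.eq_or_lt with rfl | hp
  · simp; positivity
  have h1 := Real.log_le_sub_one_of_pos (show 0 < T * w / p by positivity)
  rw [Real.log_div (by positivity) hp.ne', Real.log_mul hT.ne' hw.ne'] at h1
  have h2 := mul_le_mul_of_nonneg_left h1 hp.le
  have : p * (T * w / p - 1) = w * T - p := by field_simp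
  linarith

lemma upper_T (h : Sz α Φ) {g : ℝ} (hg1 : -1 ≤ g) (hg0 : g ≤ 0) (n : ℕ) {T : ℝ → ℝ}
    (hT : Continuous T) (hpos : ∀ θ, 0 < T θ) :
    ∫ θ, Real.log (T θ) ∂(GWm g) - ∫ θ, T θ ∂(rhon α Φ n) + 1
      ≤ Hgw g - ∫ θ, (1 + g * Real.cos θ) * Real.log (wn α Φ n θ) ∂UNIFm := by
  have hc := continuous_wn h n
  rw [integral_GWm hg1 hg0, integral_rhon h, ← entropy hg1 hg0]
  have hpc : Continuous fun θ => 1 + g * Real.cos θ := by fun_prop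
  have i1 : Integrable (fun θ => (1 + g * Real.cos θ) * Real.log (T θ)) UNIFm :=
    integrable_UNIF (hpc.mul (hT.log fun θ => (hpos θ).ne'))
  have i2 : Integrable (fun θ => wn α Φ n θ * T θ) UNIFm := integrable_UNIF (hc.mul hT)
  have i3 : Integrable (fun θ => 1 + g * Real.cos θ) UNIFm := integrable_UNIF hpc
  have i4 : Integrable (fun θ => (1 + g * Real.cos θ) * Real.log (1 + g * Real.cos θ)) UNIFm :=
    integrable_UNIF (Real.continuous_mul_log.comp hpc)
  have i5 := integrable_UNIF (cont_plog h g n)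
  simp only [smul_eq_mul]
  have i12 : Integrable (fun θ => (1 + g * Real.cos θ) * Real.log (T θ)
    - wn α Φ n θ * T θ) UNIFm := i1.sub i2
  have hp1 := integral_p g
  calc _ = ∫ θ, ((1 + g * Real.cos θ) * Real.log (T θ)
        - wn α Φ n θ * T θ + (1 + g * Real.cos θ)) ∂UNIFm := by
        rw [integral_add i12 i3, integral_sub i1 i2, hp1]
    _ ≤ ∫ θ, ((1 + g * Real.cos θ) * Real.log (1 + g * Real.cos θ)
        - (1 + g * Real.cos θ) * Real.log (wn α Φ n θ)) ∂UNIFm := ?_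
    _ = _ := integral_sub i4 i5
  refine integral_mono (i12.add i3) (i4.sub i5) fun θ => ?_
  exact pointwise_ineq (one_add_nonneg hg1 hg0 θ) (hpos θ) (wn_pos h n θ)

lemma lower_bound (h : Sz α Φ) {g : ℝ} (hg1 : -1 ≤ g) (hg0 : g ≤ 0)
    (ν : Measure ℝ) [IsProbabilityMeasure ν]
    (ho : ∀ j k, j ≠ k → Ip ν (Φ j) (Φ k) = 0) (hK : KLdiv (GWm g) ν ≠ ⊤) (n : ℕ) :
    Hgw g - ∫ θ, (1 + g * Real.cos θ) * Real.log (wn α Φ n θ) ∂UNIFm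
      ≤ (KLdiv (GWm g) ν).toReal - g * (α n * conj (pv α n)).re := by
  have := isProb_GWm hg1 hg0
  refine le_of_forall_pos_le_add fun ε hε => ?_
  obtain ⟨a, b, ha, hab⟩ := bdd_wn h n
  have hb : 0 < b := ha.trans_le ((hab 0).1.trans (hab 0).2)
  have hc := continuous_wn h n
  have hpc : Continuous fun θ => 1 + g * Real.cos θ := by fun_prop
  have hN := Nn_pos h.lt n
  have hTc : Continuous fun θ => (1 + g * Real.cos θ + ε) / wn α Φ n θ :=
    (hpc.add continuous_const).div hc fun θ => (wn_pos h n θ).ne'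
  have hdv := dv_easy (GWm g) ν hK (fun θ => (1 + g * Real.cos θ + ε) / wn α Φ n θ)
    hTc.measurable (ε / b) ((2 + ε) / a) (by positivity) (fun θ => by
      have hp := one_add_nonneg hg1 hg0 θ
      have hp2 : 1 + g * Real.cos θ ≤ 2 := by
        nlinarith [Real.cos_le_one θ, Real.neg_one_le_cos θ]
      have := wn_pos h n θ
      constructor
      · apply div_le_div₀ <;> first | positivity | linarith [(hab θ).2]
      · apply div_le_div₀ <;> first | positivity | linarith [(hab θ).1])
  have hlog : Hgw g - ∫ θ, (1 + g * Real.cos θ) * Real.log (wn α Φ n θ) ∂UNIFm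
      ≤ ∫ θ, Real.log ((1 + g * Real.cos θ + ε) / wn α Φ n θ) ∂(GWm g) := by
    rw [integral_GWm hg1 hg0, ← entropy hg1 hg0]
    have i4 : Integrable (fun θ => (1 + g * Real.cos θ) * Real.log (1 + g * Real.cos θ)) UNIFm :=
      integrable_UNIF (Real.continuous_mul_log.comp hpc)
    have i5 := integrable_UNIF (cont_plog h g n)
    rw [← integral_sub i4 i5]
    refine integral_mono (i4.sub i5) (integrable_UNIF (hpc.mul (hTc.log fun θ => ?_))) fun θ => ?_
    · have hp := one_add_nonneg hg1 hg0 θ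
      have := wn_pos h n θ
      positivity
    · have hp := one_add_nonneg hg1 hg0 θ
      have hw := wn_pos h n θ
      simp only
      rw [Real.log_div (by positivity) hw.ne', mul_sub]
      rcases hp.eq_or_lt with h0 | hp
      · rw [← h0]; simp
      · have := Real.log_le_log hp (by linarith : 1 + g * Real.cos θ ≤ 1 + g * Real.cos θ + ε)
        have := mul_le_mul_of_nonneg_left this hp.le
        linarith
  have hT : ∫ θ, (1 + g * Real.cos θ + ε) / wn α Φ n θ ∂ν
      = 1 + ε - g * (α n * conj (pv α n)).re := by
    have e : ∀ θ, (1 + g * Real.cos θ + ε) / wn α Φ n θ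
        = (Nn α n)⁻¹ * (((1 + ε : ℝ) : ℂ) * (conj ((Φ n).eval (ctheta θ)) * (Φ n).eval (ctheta θ))
          + (g : ℂ) * (conj ((Φ n).eval (ctheta θ)) * (X * Φ n).eval (ctheta θ))).re := by
      intro θ
      have hne := norm_ne_zero_iff.2 (h.ne_zero n θ)
      have h1 : conj ((Φ n).eval (ctheta θ)) * (Φ n).eval (ctheta θ)
          = ((‖(Φ n).eval (ctheta θ)‖^2 : ℝ) : ℂ) := by
        rw [mul_comm, Complex.mul_conj']; push_cast; rfl
      have h2 : conj ((Φ n).eval (ctheta θ)) * (X * Φ n).eval (ctheta θ)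
          = ((‖(Φ n).eval (ctheta θ)‖^2 : ℝ) : ℂ) * ctheta θ := by
        rw [← h1, eval_mul, eval_X]; ring
      rw [h1, h2, Complex.add_re, Complex.re_ofReal_mul, Complex.re_ofReal_mul,
        Complex.re_ofReal_mul, re_ctheta, Complex.ofReal_re, wn]
      field_simp
      ring
    simp_rw [e]
    have j1 := (integrable_pp ν (Φ n) (Φ n)).const_mul ((1 + ε : ℝ) : ℂ)
    have j2 := (integrable_pp ν (Φ n) (X * Φ n)).const_mul (g : ℂ)
    have j3 := integral_re (j1.add j2)
    simp only [RCLike.re_to_complex, Pi.add_apply] at j3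
    rw [integral_const_mul, j3, integral_add j1 j2, integral_const_mul, integral_const_mul,
      ← Ip_apply, ← Ip_apply, norm_sq_nu h ν ho, shift_nu h ν ho, h.eval_zero', ← mul_assoc,
      Complex.add_re, ← Complex.ofReal_mul, Complex.ofReal_re, Complex.re_mul_ofReal,
      Complex.re_ofReal_mul]
    simp only [map_neg, Complex.conj_conj, Complex.mul_re, Complex.neg_re, Complex.neg_im,
      Complex.conj_re, Complex.conj_im]
    field_simp
    ring
  linarith

end An

lemma F_ge {g x : ℝ} (hg1 : -1 ≤ g) (hx0 : 0 ≤ x) (hx1 : x < 1) :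
    (x/2)^2 ≤ -Real.log (1 - x) + g * x := by
  have hy : 0 < 1 - x := by linarith
  set y := Real.sqrt (1 - x) with hyd
  have hy0 : 0 < y := Real.sqrt_pos.2 hy
  have hy2 : y^2 = 1 - x := Real.sq_sqrt hy.le
  have h1 : Real.log (1 - x) = 2 * Real.log y := by
    rw [← hy2, Real.log_pow]; norm_num
  have h2 := Real.log_le_sub_one_of_pos hy0
  have h3 : y ≤ 1 - x/2 := by
    apply Real.sqrt_le_iff.2 ⟨by linarith, by nlinarith⟩
  nlinarith

lemma tk_ge {g : ℝ} (hg1 : -1 ≤ g) (hg0 : g ≤ 0) {α : ℕ → ℂ} (hα : ∀ k, ‖α k‖ < 1) (k : ℕ) :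
    (‖α k‖^2/2)^2 ≤ tk g α k := by
  have h := F_ge hg1 (sq_nonneg ‖α k‖) (by nlinarith [hα k, norm_nonneg (α k)])
  have h2 : 0 ≤ -(g/2) * ‖α k - pv α k‖^2 := mul_nonneg (by linarith) (by positivity)
  rw [tk]; linarith

lemma alpha_tendsto {g : ℝ} (hg1 : -1 ≤ g) (hg0 : g ≤ 0) {α : ℕ → ℂ} (hα : ∀ k, ‖α k‖ < 1)
    (hs : Summable (tk g α)) : Tendsto (fun n => ‖α n‖^2) atTop (𝓝 0) := by
  have h1 : Tendsto (fun n => (‖α n‖^2/2)^2) atTop (𝓝 0) :=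
    squeeze_zero (fun n => by positivity) (tk_ge hg1 hg0 hα) hs.tendsto_atTop_zero
  have h2 := (h1.sqrt).const_mul 2
  simp only [Real.sqrt_zero, mul_zero] at h2
  refine h2.congr fun n => ?_
  rw [Real.sqrt_sq (by positivity)]; ring

lemma upper_bound {g : ℝ} (hg1 : -1 ≤ g) (hg0 : g ≤ 0) {α : ℕ → ℂ} {Φ : ℕ → ℂ[X]}
    (h : Sz α Φ) (ν : Measure ℝ) [IsProbabilityMeasure ν] (hcirc : ν (Ico 0 (2*π))ᶜ = 0)
    (ho : ∀ j k, j ≠ k → Ip ν (Φ j) (Φ k) = 0) (hs : Summable (tk g α)) :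
    0 ≤ Hgw g + g/2 + ∑' k, tk g α k ∧
    KLdiv (GWm g) ν ≤ ENNReal.ofReal (Hgw g + g/2 + ∑' k, tk g α k) := by
  have hprob := isProb_GWm hg1 hg0
  have hlim : Tendsto (fun n => Hgw g - ∫ θ, (1 + g * Real.cos θ) * Real.log (wn α Φ n θ) ∂UNIFm)
      atTop (𝓝 (Hgw g + g/2 + ∑' k, tk g α k)) := by
    have h1 := (alpha_tendsto hg1 hg0 h.lt hs)
    have h2 : Tendsto (fun n => ‖pv α n‖^2) atTop (𝓝 0) := by
      rw [← tendsto_add_atTop_iff_nat 1]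
      simpa [pv] using h1
    have h3 := (hs.hasSum.tendsto_sum_nat.const_add (Hgw g + g/2)).sub (h2.const_mul (g/2))
    simp only [mul_zero, sub_zero] at h3
    exact h3.congr fun n => (An_eq h g n).symm
  have H : ∀ q ∈ Submodule.span ℂ (range (fun n:ℤ => (fourier n : C(AddCircle (2*π),ℂ)))),
      ∀ a b, 0 < a → (∀ x, (q x).re ∈ Icc a b) →
      ∫ θ : ℝ, Real.log (q (θ : AddCircle (2*π))).re ∂(GWm g)
        - ∫ θ : ℝ, (q (θ : AddCircle (2*π))).re ∂ν + 1 ≤ Hgw g + g/2 + ∑' k, tk g α k := by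
    intro q hq a b ha hab
    refine ge_of_tendsto hlim ?_
    filter_upwards [match_fourier h ν ho q hq] with n hn
    have hqc : Continuous fun θ : ℝ => q (θ : AddCircle (2*π)) :=
      q.continuous.comp (AddCircle.continuous_mk' _)
    have hi : ∀ (ρ : Measure ℝ) [IsFiniteMeasure ρ],
        Integrable (fun θ : ℝ => q (θ : AddCircle (2*π))) ρ := by
      intro ρ _
      have := fact_two_pi
      exact Integrable.of_bound hqc.aestronglyMeasurable ‖q‖
        (Eventually.of_forall fun θ => q.norm_coe_le_norm _)
    have := isFinite_rhon h n
    have e1 := integral_re (hi ν)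
    have e2 := integral_re (hi (rhon α Φ n))
    simp only [RCLike.re_to_complex] at e1 e2
    rw [e1, hn, ← e2]
    exact upper_T h hg1 hg0 n (Complex.continuous_re.comp hqc) fun θ => ha.trans_le (hab _).1
  refine ⟨?_, kl_le_of_trig (GWm g) ν (GWm_compl hg1 hg0) hcirc _ H⟩
  have := H (fourier 0) (Submodule.subset_span ⟨0, rfl⟩) 1 1 one_pos (fun x => by simp)
  simpa using this

lemma lower_sum {g : ℝ} (hg1 : -1 ≤ g) (hg0 : g ≤ 0) {α : ℕ → ℂ} {Φ : ℕ → ℂ[X]}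
    (h : Sz α Φ) (ν : Measure ℝ) [IsProbabilityMeasure ν]
    (ho : ∀ j k, j ≠ k → Ip ν (Φ j) (Φ k) = 0) (hK : KLdiv (GWm g) ν ≠ ⊤) :
    Summable (tk g α) ∧ Hgw g + g/2 + ∑' k, tk g α k ≤ (KLdiv (GWm g) ν).toReal := by
  have hb : ∀ n, ∑ k ∈ Finset.range n, tk g α k
      ≤ (KLdiv (GWm g) ν).toReal - (Hgw g + g/2) + -(g/2) * ‖α n‖^2 := by
    intro n
    have h1 := lower_bound h hg1 hg0 ν ho hK n
    rw [An_eq h] at h1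
    have : ‖α n - pv α n‖^2 = ‖α n‖^2 + ‖pv α n‖^2 - 2 * (α n * conj (pv α n)).re := by
      simp only [← Complex.normSq_eq_norm_sq, Complex.normSq_sub]
    have h2 : 0 ≤ -(g/2) * ‖α n - pv α n‖^2 := mul_nonneg (by linarith) (by positivity)
    rw [this] at h2
    linarith
  have hs : Summable (tk g α) := by
    refine summable_of_sum_range_le (c := (KLdiv (GWm g) ν).toReal - (Hgw g + g/2) + 1)
      (fun k => le_trans (by positivity) (tk_ge hg1 hg0 h.lt k)) fun n => (hb n).trans ?_
    have h1 : ‖α n‖^2 ≤ 1 := by nlinarith [h.lt n, norm_nonneg (α n)]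
    nlinarith [sq_nonneg ‖α n‖]
  refine ⟨hs, ?_⟩
  have h1 := ((alpha_tendsto hg1 hg0 h.lt hs).const_mul (-(g/2))).const_add
    ((KLdiv (GWm g) ν).toReal - (Hgw g + g/2))
  simp only [mul_zero, add_zero] at h1
  have := le_of_tendsto_of_tendsto' hs.hasSum.tendsto_sum_nat h1 hb
  linarith

/-- **Gross–Witten sum rule** (strongly coupled phase `-1 ≤ g ≤ 0`).
The finite constant `H(g) + g/2 (≤ 0)` has been moved to the left-hand side. -/
theorem gross_witten_sum_rule (g : ℝ) (hg1 : -1 ≤ g) (hg0 : g ≤ 0)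
    (ν : Measure ℝ) [IsProbabilityMeasure ν] (hcirc : ν (Ico 0 (2*π))ᶜ = 0)
    (hnt : InfiniteSupport ν) (α : ℕ → ℂ) (hα : IsVerblunsky ν α) :
    KLdiv (GWm g) UNIFm = ENNReal.ofReal (Hgw g) ∧
    KLdiv (GWm g) ν + ENNReal.ofReal (-(Hgw g + g/2)) =
      ENNReal.ofReal (-(g/2))
        * ∑' k : ℕ, ENNReal.ofReal (‖α k - (if k = 0 then -1 else α (k-1))‖^2)
      + ∑' k : ℕ, ENNReal.ofReal (-Real.log (1 - ‖α k‖^2) + g * ‖α k‖^2) := by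


  refine ⟨KL_GW_UNIF hg1 hg0, ?_⟩
  obtain ⟨hlt, Φ, hm, hd, ho, hr⟩ := hα
  have h : Sz α Φ := ⟨hlt, hm, hd, hr⟩
  have ho' : ∀ j k, j ≠ k → Ip ν (Φ j) (Φ k) = 0 := ho
  have ht0 : ∀ k, 0 ≤ tk g α k := fun k => le_trans (by positivity) (tk_ge hg1 hg0 hlt k)
  have hR : ENNReal.ofReal (-(g/2))
        * ∑' k : ℕ, ENNReal.ofReal (‖α k - (if k = 0 then -1 else α (k-1))‖^2)
      + ∑' k : ℕ, ENNReal.ofReal (-Real.log (1 - ‖α k‖^2) + g * ‖α k‖^2)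
      = ∑' k, ENNReal.ofReal (tk g α k) := by
    rw [← ENNReal.tsum_mul_left, ← ENNReal.tsum_add]
    congr 1; funext k
    have hF := F_ge hg1 (sq_nonneg ‖α k‖) (by nlinarith [hlt k, norm_nonneg (α k)])
    rw [← ENNReal.ofReal_mul (by linarith), ← ENNReal.ofReal_add
      (mul_nonneg (by linarith) (by positivity)) (le_trans (by positivity) hF)]
    rfl
  rw [hR]
  have hneg := Hgw_nonpos hg1 hg0
  by_cases hK : KLdiv (GWm g) ν = ⊤
  · rw [hK, top_add]
    by_contra hne
    have hs : Summable (tk g α) := by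
      have := ENNReal.summable_toReal (Ne.symm hne)
      simpa only [ENNReal.toReal_ofReal (ht0 _)] using this
    have := (upper_bound hg1 hg0 h ν hcirc ho' hs).2
    rw [hK] at this
    exact absurd this (by simp)
  · obtain ⟨hs, hlow⟩ := lower_sum hg1 hg0 h ν ho' hK
    obtain ⟨hM, hup⟩ := upper_bound hg1 hg0 h ν hcirc ho' hs
    have hup' := ENNReal.toReal_le_of_le_ofReal hM hup
    have hKeq : KLdiv (GWm g) ν = ENNReal.ofReal (Hgw g + g/2 + ∑' k, tk g α k) := by
      rw [← le_antisymm hup' hlow, ENNReal.ofReal_toReal hK]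
    rw [hKeq, ← ENNReal.ofReal_add hM (by linarith), ← ENNReal.ofReal_tsum_of_nonneg ht0 hs]
    congr 1; ring

end SumRules
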